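/- Let ρ2 be an unbounded sublinear function. Then there exist integers N_r ≥ 6 (r ≥ 1) such that the set of relators R := {(a^r b a^r b⁻¹)^{N_r} : r ≥ 1} over S = {a,b} satisfies the classical C'(1/6) condition, and the group G = ⟨a,b | R⟩ has the following properties: (i) there exists ρ2' ≍ ρ2 such that every virtually cyclic subgroup E of G containing a is (r,ρ2')-contracting in Cay(G,S); (ii) for every integer r ≥ 1, the element a^r b a^r b⁻¹ of G is nontrivial and of finite order; consequently, for every r ≥ 1 the normal closure of a^r in G is not a free group (and hence, by Dahmani–Guirardel–Osin, no virtually cyclic subgroup of G containing a is hyperbolically embedded in G). -/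

import Mathlib

/- Common definitions: words, classical C'(1/6) presentations, word metrics,
   contraction, Morse property, etc. -/

namespace GSC

open Filter

/-- A word over the alphabet `S`: a list of letters with an exponent `±1`
(`true` = the letter, `false` = its formal inverse). -/
abbrev Word (S : Type) := List (S × Bool)

/-- The formal inverse of a word. -/
def wordInv {S : Type} (w : Word S) : Word S := (w.map fun l => (l.1, !l.2)).reverse

/-- A word is (freely) reduced if no letter is followed by its formal inverse. -/
def Reduced {S : Type} (w : Word S) : Prop :=
  List.Chain' (fun a b => a.1 ≠ b.1 ∨ a.2 = b.2) w

/-- A word is cyclically reduced if its square is reduced. -/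
def CyclicallyReduced {S : Type} (w : Word S) : Prop := Reduced (w ++ w)

/-- A piece with respect to a set of relators `R`: a word occurring as a prefix of
two distinct elements of `R`. -/
def IsPiece {S : Type} (R : Set (Word S)) (p : Word S) : Prop :=
  ∃ r₁ ∈ R, ∃ r₂ ∈ R, r₁ ≠ r₂ ∧ p <+: r₁ ∧ p <+: r₂

/-- Closure of a set of words under inversion and cyclic permutation. -/
def symmClosure {S : Type} (R : Set (Word S)) : Set (Word S) :=
  {w | ∃ r ∈ R, ∃ n : ℕ, w = r.rotate n ∨ w = wordInv (r.rotate n)}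

/-- A classical `C'(1/den)` collection of cyclically reduced words: after closing under
inversion and cyclic permutation, every piece `p` contained in a relator `r` satisfies
`den * |p| < |r|`. -/
def CprimeCollection {S : Type} (den : ℕ) (R : Set (Word S)) : Prop :=
  (∀ r ∈ R, CyclicallyReduced r) ∧
  ∀ r ∈ symmClosure R, ∀ p : Word S, p <+: r → IsPiece (symmClosure R) p →
    den * p.length < r.length

/-- A classical `C'(1/6)` presentation: a set of cyclically reduced relators, closed under
inversion and cyclic permutation, in which every piece contained in a relator `r` has
length `< |r|/6`. -/
structure C6Presentation (S : Type) where
  rels : Set (Word S)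
  cyclically_reduced : ∀ r ∈ rels, CyclicallyReduced r
  inv_mem : ∀ r ∈ rels, wordInv r ∈ rels
  rotate_mem : ∀ r ∈ rels, ∀ n : ℕ, r.rotate n ∈ rels
  small_cancellation : ∀ r ∈ rels, ∀ p : Word S, p <+: r → IsPiece rels p →
    6 * p.length < r.length

/-- The element of the free group represented by a word. -/
def wordVal {S : Type} (w : Word S) : FreeGroup S :=
  (w.map fun l => (FreeGroup.of l.1) ^ (if l.2 then (1 : ℤ) else -1)).prod

/-- The group defined by a `C'(1/6)` presentation. -/
abbrev C6Presentation.Grp {S : Type} (P : C6Presentation S) : Type :=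
  PresentedGroup (wordVal '' P.rels)

/-- The generating set of the presented group (the images of the letters of `S`). -/
def C6Presentation.gens {S : Type} (P : C6Presentation S) : Set P.Grp :=
  Set.range fun a : S => (PresentedGroup.of a : P.Grp)

/-- The element of the presented group represented by a word. -/
def C6Presentation.elt {S : Type} (P : C6Presentation S) (w : Word S) : P.Grp :=
  (w.map fun l => (PresentedGroup.of l.1 : P.Grp) ^ (if l.2 then (1 : ℤ) else -1)).prod

/-- The word length of `g` with respect to a generating set `S ⊆ G`: the least `n`
such that `g` is a product of `n` elements of `S ∪ S⁻¹`. -/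
noncomputable def wordLength {G : Type*} [Group G] (S : Set G) (g : G) : ℕ :=
  sInf {n : ℕ | ∃ l : List G, l.length = n ∧ (∀ x ∈ l, x ∈ S ∨ x⁻¹ ∈ S) ∧ l.prod = g}

/-- The word metric on `G` with respect to `S`, as a real-valued function. -/
noncomputable def wdist {G : Type*} [Group G] (S : Set G) (g h : G) : ℝ :=
  (wordLength S (g⁻¹ * h) : ℝ)

/-- Distance from a point to a subset, in the word metric. -/
noncomputable def setDist {G : Type*} [Group G] (S : Set G) (x : G) (Y : Set G) : ℝ :=
  sInf (wdist S x '' Y)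

/-- Closest point projection to a subset `Y`, in the word metric. -/
def proj {G : Type*} [Group G] (S : Set G) (Y : Set G) (x : G) : Set G :=
  {y ∈ Y | wdist S x y = setDist S x Y}

/-- Diameter of a subset, in the word metric. -/
noncomputable def setDiam {G : Type*} [Group G] (S : Set G) (A : Set G) : ℝ :=
  sSup {d : ℝ | ∃ x ∈ A, ∃ y ∈ A, d = wdist S x y}

/-- Admissibility of a pair of contraction gauges `(ρ₁, ρ₂)`: both non-decreasing and
eventually non-negative, `ρ₁ r ≤ r`, `ρ₁` unbounded, and `ρ₂/ρ₁ → 0` at infinity. -/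
def Admissible (ρ₁ ρ₂ : ℝ → ℝ) : Prop :=
  Monotone ρ₁ ∧ Monotone ρ₂ ∧
  (∀ᶠ r in atTop, 0 ≤ ρ₁ r) ∧ (∀ᶠ r in atTop, 0 ≤ ρ₂ r) ∧
  (∀ r : ℝ, ρ₁ r ≤ r) ∧ (∀ M : ℝ, ∃ r : ℝ, M ≤ ρ₁ r) ∧
  Tendsto (fun r => ρ₂ r / ρ₁ r) atTop (nhds 0)

/-- `Y` is `(ρ₁,ρ₂)`-contracting inside the subspace `X` (with the metric induced by the
word metric of `S`): whenever `x, x' ∈ X` satisfy `d(x,x') ≤ ρ₁(d(x,Y))`, the projections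
`π(x) ∪ π(x')` have diameter at most `ρ₂(d(x,Y))`. -/
def ContractingIn {G : Type*} [Group G] (S : Set G) (X Y : Set G) (ρ₁ ρ₂ : ℝ → ℝ) : Prop :=
  Admissible ρ₁ ρ₂ ∧
  ∀ x ∈ X, ∀ x' ∈ X, wdist S x x' ≤ ρ₁ (setDist S x Y) →
    ∀ y ∈ proj S Y x ∪ proj S Y x', ∀ y' ∈ proj S Y x ∪ proj S Y x',
      wdist S y y' ≤ ρ₂ (setDist S x Y)

/-- `Y` is `(ρ₁,ρ₂)`-contracting in `Cay(G,S)`. -/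
def ContractingWith {G : Type*} [Group G] (S : Set G) (ρ₁ ρ₂ : ℝ → ℝ) (Y : Set G) : Prop :=
  ContractingIn S Set.univ Y ρ₁ ρ₂

/-- `Y` is strongly contracting: `(r, C)`-contracting for some constant `C`. -/
def StronglyContracting {G : Type*} [Group G] (S : Set G) (Y : Set G) : Prop :=
  ∃ C : ℝ, ContractingWith S (fun r => r) (fun _ => C) Y

/-- A sublinear function: non-decreasing, eventually non-negative, `f(r)/r → 0`. -/
def Sublinear (f : ℝ → ℝ) : Prop :=
  Monotone f ∧ (∀ᶠ r in atTop, 0 ≤ f r) ∧ Tendsto (fun r => f r / r) atTop (nhds 0)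

/-- `f ⪯ g`: there are constants `C₁, C₂ > 0` and `C₃, C₄ ≥ 0` with
`f(x) ≤ C₁ g(C₂ x + C₃) + C₄` for all `x`. -/
def Preceq (f g : ℝ → ℝ) : Prop :=
  ∃ C₁ C₂ C₃ C₄ : ℝ, 0 < C₁ ∧ 0 < C₂ ∧ 0 ≤ C₃ ∧ 0 ≤ C₄ ∧
    ∀ x : ℝ, f x ≤ C₁ * g (C₂ * x + C₃) + C₄

/-- `f ≍ g`: `f ⪯ g` and `g ⪯ f`. -/
def Asymp (f g : ℝ → ℝ) : Prop := Preceq f g ∧ Preceq g f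

/-- `α ⊆ G` is a geodesic of `Cay(G,S)`: the image of an isometric embedding of a
subinterval of `ℤ` into `(G, d_S)`. -/
def IsGeodesic {G : Type*} [Group G] (S : Set G) (α : Set G) : Prop :=
  ∃ (I : Set ℤ) (γ : ℤ → G), I.OrdConnected ∧
    (∀ m ∈ I, ∀ n ∈ I, wdist S (γ m) (γ n) = |(m : ℝ) - (n : ℝ)|) ∧ α = γ '' I

/-- `α ⊆ G` is a bi-infinite geodesic of `Cay(G,S)`. -/
def IsBiInfGeodesic {G : Type*} [Group G] (S : Set G) (α : Set G) : Prop :=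
  ∃ γ : ℤ → G, (∀ m n : ℤ, wdist S (γ m) (γ n) = |(m : ℝ) - (n : ℝ)|) ∧ α = Set.range γ

/-- `Y` is Morse: there is `μ` such that every `(L,A)`-quasi-geodesic with endpoints on
`Y` stays in the `μ(L,A)`-neighborhood of `Y`. -/
def IsMorse {G : Type*} [Group G] (S : Set G) (Y : Set G) : Prop :=
  ∃ μ : ℝ → ℝ → ℝ, ∀ L A : ℝ, 1 ≤ L → 0 ≤ A →
    ∀ (q : ℤ → G) (m n : ℤ), m ≤ n → q m ∈ Y → q n ∈ Y →
    (∀ i j : ℤ, m ≤ i → i ≤ n → m ≤ j → j ≤ n →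
      L⁻¹ * |(i : ℝ) - (j : ℝ)| - A ≤ wdist S (q i) (q j) ∧
      wdist S (q i) (q j) ≤ L * |(i : ℝ) - (j : ℝ)| + A) →
    ∀ i : ℤ, m ≤ i → i ≤ n → setDist S (q i) Y ≤ μ L A

/-- Two subsets are at finite Hausdorff distance in the word metric. -/
def FinHausdorffDist {G : Type*} [Group G] (S : Set G) (A B : Set G) : Prop :=
  ∃ ε : ℝ, (∀ a ∈ A, ∃ b ∈ B, wdist S a b ≤ ε) ∧ ∀ b ∈ B, ∃ a ∈ A, wdist S a b ≤ ε

/-- The embedded relator cycle determined by `g ∈ G(Γ)` and a relator `r`: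
the set `{g ⋅ p̄ : p a prefix of r}`. -/
def relatorCycle {S : Type} (P : C6Presentation S) (g : P.Grp) (r : Word S) :
    Set P.Grp :=
  {x | ∃ p : Word S, p <+: r ∧ x = g * P.elt p}

/-- A geodesic `α` is locally `(ρ₁,ρ₂)`-contracting: for every embedded relator cycle
`Γ₀` meeting `α`, the set `Γ₀ ∩ α` is `(ρ₁,ρ₂)`-contracting as a subspace of `Γ₀`. -/
def LocallyContracting {S : Type} (P : C6Presentation S) (α : Set P.Grp)
    (ρ₁ ρ₂ : ℝ → ℝ) : Prop :=
  ∀ (g : P.Grp) (r : Word S), r ∈ P.rels → (relatorCycle P g r ∩ α).Nonempty →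
    ContractingIn P.gens (relatorCycle P g r) (relatorCycle P g r ∩ α) ρ₁ ρ₂

/-- The generating set `S ∪ W` of the coned-off space: `W` is the set of elements
represented by subwords of cyclic permutations of relators (equivalently, by prefixes
of relators, since the relator set is closed under cyclic permutation). -/
def conedGens {S : Type} (P : C6Presentation S) : Set P.Grp :=
  P.gens ∪ {x | ∃ r ∈ P.rels, ∃ p : Word S, p <+: r ∧ x = P.elt p}

/-- The exponential growth rate of `(G,S)`. -/
noncomputable def growthRate {G : Type*} [Group G] (S : Set G) : ℝ :=
  limsup (fun n : ℕ => Real.log (Nat.card {g : G // wordLength S g ≤ n}) / (n : ℝ)) atTop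

/-- Quasi-isometry of marked groups `(G,S)` and `(H,T)` via word metrics. -/
def QIsom {G H : Type*} [Group G] [Group H] (S : Set G) (T : Set H) : Prop :=
  ∃ (f : G → H) (L A : ℝ), 1 ≤ L ∧ 0 ≤ A ∧
    (∀ x y : G, L⁻¹ * wdist S x y - A ≤ wdist T (f x) (f y) ∧
      wdist T (f x) (f y) ≤ L * wdist S x y + A) ∧
    ∀ h : H, ∃ x : G, wdist T (f x) h ≤ A

/-- A subgroup is virtually cyclic if it contains a cyclic subgroup of finite index. -/
def VirtuallyCyclic {G : Type*} [Group G] (E : Subgroup G) : Prop :=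
  ∃ g : G, Subgroup.zpowers g ≤ E ∧ ((Subgroup.zpowers g).subgroupOf E).index ≠ 0

end GSC
namespace GSC

/-- The word `(a^r b a^r b⁻¹)^n` over the alphabet `{a,b}` (with `a = 0`, `b = 1`). -/
def relWord13 (r n : ℕ) : Word (Fin 2) :=
  (List.replicate n
    (List.replicate r ((0 : Fin 2), true) ++ [((1 : Fin 2), true)] ++
      List.replicate r ((0 : Fin 2), true) ++ [((1 : Fin 2), false)])).flatten

section Coxeter

variable {B W : Type*} [Group W] {M : CoxeterMatrix B} (cs : CoxeterSystem M W)

open CoxeterSystem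

/-- The action of a simple reflection on signed elements, from which the inversion
cocycle of a Coxeter system is built. -/
noncomputable def signedSimple (i : B) : Function.End (W × ZMod 2) := by
  classical
  exact fun p => (cs.simple i * p.1 * cs.simple i, p.2 + if p.1 = cs.simple i then 1 else 0)

open Classical in
theorem signedSimple_mul_pow (i j : B) (n : ℕ) (t : W) (e : ZMod 2) :
    ((signedSimple cs i * signedSimple cs j) ^ n) (t, e) =
      ((cs.simple i * cs.simple j) ^ n * t * ((cs.simple i * cs.simple j) ^ n)⁻¹,
        e + ∑ k ∈ Finset.range (2 * n),
          if t = ((cs.simple i * cs.simple j) ^ k)⁻¹ * cs.simple j then 1 else 0) := by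
  set c := cs.simple i * cs.simple j with hc
  have hsc : ∀ k : ℕ, cs.simple j * c ^ k = (c ^ k)⁻¹ * cs.simple j := by
    intro k
    induction k with
    | zero => simp
    | succ k ih =>
      have h1 : cs.simple j * c = c⁻¹ * cs.simple j := by simp [hc, mul_assoc]
      rw [pow_succ, ← mul_assoc, ih, mul_assoc, h1, ← mul_assoc, ← mul_inv_rev, ← pow_succ',
        pow_succ]
  induction n with
  | zero => simp; rfl
  | succ n ih =>
    rw [pow_succ']
    change (signedSimple cs i * signedSimple cs j)
      (((signedSimple cs i * signedSimple cs j) ^ n) (t, e)) = _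
    rw [ih]
    have e1 : (c ^ n * t * (c ^ n)⁻¹ = cs.simple j) ↔
        t = (c ^ (2 * n))⁻¹ * cs.simple j := by
      rw [two_mul, pow_add, mul_inv_rev, mul_assoc _ _ (cs.simple j), ← hsc n,
        mul_inv_eq_iff_eq_mul, eq_inv_mul_iff_mul_eq]
    have e2 : (cs.simple j * (c ^ n * t * (c ^ n)⁻¹) * cs.simple j = cs.simple i) ↔
        t = (c ^ (2 * n + 1))⁻¹ * cs.simple j := by
      have h3 : (cs.simple j * (c ^ n * t * (c ^ n)⁻¹) * cs.simple j = cs.simple i) ↔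
          c ^ n * t * (c ^ n)⁻¹ = c⁻¹ * cs.simple j := by
        have : cs.simple j * cs.simple i * cs.simple j = c⁻¹ * cs.simple j := by simp [hc]
        rw [← this]
        constructor
        · intro h
          rw [← h]; simp [mul_assoc]
        · intro h
          rw [h]; simp [mul_assoc]
      have h4 : (c ^ (2 * n + 1))⁻¹ * cs.simple j = (c ^ n)⁻¹ * (c⁻¹ * cs.simple j * c ^ n) := by
        rw [mul_assoc c⁻¹, hsc n, ← mul_assoc c⁻¹, ← mul_inv_rev, ← mul_assoc, ← mul_inv_rev,
          ← pow_succ, ← pow_add]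
        congr 3; ring
      rw [h3, h4, mul_inv_eq_iff_eq_mul, eq_inv_mul_iff_mul_eq]
    change (cs.simple i * (cs.simple j * (c ^ n * t * (c ^ n)⁻¹) * cs.simple j) * cs.simple i,
      _ + _ + (if cs.simple j * (c ^ n * t * (c ^ n)⁻¹) * cs.simple j = cs.simple i
        then 1 else 0)) = _
    rw [mul_add_one, Finset.sum_range_succ, Finset.sum_range_succ]
    simp only [e1, e2]
    refine Prod.ext ?_ ?_
    · simp only [pow_succ', mul_inv_rev]
      simp [hc, mul_assoc]
    · simp only
      ring

theorem isLiftable_signedSimple : M.IsLiftable (signedSimple cs) := by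
  classical
  intro i j
  funext p
  obtain ⟨t, e⟩ := p
  rw [signedSimple_mul_pow, cs.simple_mul_simple_pow, two_mul, Finset.sum_range_add]
  simp only [pow_add, cs.simple_mul_simple_pow, one_mul]
  rw [CharTwo.add_self_eq_zero]
  simp; rfl

/-- The lift of `signedSimple` to the Coxeter group. -/
noncomputable def signedAction : W →* Function.End (W × ZMod 2) :=
  cs.lift ⟨signedSimple cs, isLiftable_signedSimple cs⟩

theorem signedAction_apply (u t : W) (e : ZMod 2) :
    signedAction cs u (t, e) = (u * t * u⁻¹, e + (signedAction cs u (t, 0)).2) := by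
  classical
  induction u using cs.simple_induction_left generalizing e with
  | one =>
    rw [map_one]
    change (t, e) = (_, e + 0)
    simp
  | mul_simple_left u i ih =>
    have h : ∀ e, signedAction cs (cs.simple i * u) (t, e) =
        signedSimple cs i (signedAction cs u (t, e)) := by
      intro e
      rw [map_mul]
      change (signedAction cs (cs.simple i)) _ = _
      rw [signedAction, cs.lift_apply_simple]
    rw [h, h, ih]
    simp only [signedSimple]
    refine Prod.ext ?_ ?_
    · simp [mul_assoc]
    · have : (signedAction cs u (t, 0)).1 = u * t * u⁻¹ := by rw [ih]
      simp only [this]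
      rw [add_assoc]

/-- The inversion cocycle: `sep cs t w = 1` when the wall of the reflection `t` separates
`1` from `w`. -/
noncomputable def sep (t w : W) : ZMod 2 := (signedAction cs w⁻¹ (t, 0)).2

theorem sep_one (t : W) : sep cs t 1 = 0 := by
  simp [sep]; rfl

theorem sep_mul (t u w : W) : sep cs t (u * w) = sep cs t u + sep cs (u⁻¹ * t * u) w := by
  rw [sep, mul_inv_rev, map_mul]
  change (signedAction cs w⁻¹ (signedAction cs u⁻¹ (t, 0))).2 = _
  have : signedAction cs u⁻¹ (t, 0) = (u⁻¹ * t * u, sep cs t u) := by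
    rw [signedAction_apply, inv_inv, zero_add, sep]
  rw [this, signedAction_apply]
  rfl

open Classical in
theorem sep_simple (t : W) (i : B) : sep cs t (cs.simple i) = if t = cs.simple i then 1 else 0 := by
  rw [sep, cs.inv_simple, signedAction, cs.lift_apply_simple]
  simp [signedSimple]

open Classical in
theorem sep_simple_mul (t w : W) (i : B) : sep cs t (cs.simple i * w) =
    (if t = cs.simple i then 1 else 0) + sep cs (cs.simple i * t * cs.simple i) w := by
  rw [sep_mul, sep_simple, cs.inv_simple]

open Classical in
theorem sep_mul_simple (t w : W) (i : B) : sep cs t (w * cs.simple i) =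
    sep cs t w + (if w⁻¹ * t * w = cs.simple i then 1 else 0) := by
  rw [sep_mul, sep_simple]

theorem length_mul_lt_of_sep (t w : W) (h : sep cs t w = 1) : cs.length (t * w) < cs.length w := by
  classical
  have key : ∀ ω : List B, sep cs t (cs.wordProd ω) = 1 →
      ∃ ω₁ j ω₂, ω = ω₁ ++ j :: ω₂ ∧ t * cs.wordProd ω₁ = cs.wordProd ω₁ * cs.simple j := by
    intro ω
    induction ω using List.reverseRecOn with
    | nil => intro h; simp [sep_one] at h
    | append_singleton ω i ih =>
      intro h
      rw [cs.wordProd_append, cs.wordProd_singleton, sep_mul_simple] at h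
      split_ifs at h with hc
      · refine ⟨ω, i, [], rfl, ?_⟩
        rw [← hc]; group
      · rw [add_zero] at h
        obtain ⟨ω₁, j, ω₂, rfl, h2⟩ := ih h
        exact ⟨ω₁, j, ω₂ ++ [i], by simp, h2⟩
  obtain ⟨ω, hω, rfl⟩ := cs.exists_isReduced w
  obtain ⟨ω₁, j, ω₂, rfl, h2⟩ := key ω h
  rw [hω.eq, cs.wordProd_append, ← mul_assoc, h2, cs.wordProd_cons, mul_assoc,
    cs.simple_mul_simple_cancel_left, ← cs.wordProd_append]
  refine (cs.length_wordProd_le _).trans_lt ?_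
  simp

theorem isLeftDescent_iff_sep (w : W) (b : B) :
    cs.IsLeftDescent w b ↔ sep cs (cs.simple b) w = 1 := by
  constructor
  · intro h
    by_contra h0
    have h0' : sep cs (cs.simple b) w = 0 := by
      generalize sep cs (cs.simple b) w = a at h0
      revert a; decide
    have h1 : sep cs (cs.simple b) (cs.simple b * w) = 1 := by
      rw [sep_simple_mul]; simp [h0']
    have := length_mul_lt_of_sep cs _ _ h1
    rw [cs.simple_mul_simple_cancel_left] at this
    exact absurd h (by unfold IsLeftDescent; omega)
  · exact length_mul_lt_of_sep cs _ _

/-- The folding condition: a wall separating two adjacent elements is the one between them. -/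
theorem simple_mul_eq_mul_simple {w : W} {b j : B}
    (h : ¬ (cs.IsLeftDescent w b ↔ cs.IsLeftDescent (w * cs.simple j) b)) :
    cs.simple b * w = w * cs.simple j := by
  classical
  rw [isLeftDescent_iff_sep, isLeftDescent_iff_sep, sep_mul_simple] at h
  split_ifs at h with hc
  · rw [← hc]; group
  · simp at h

theorem isLeftDescent_simple_mul {w : W} {b : B} :
    cs.IsLeftDescent (cs.simple b * w) b ↔ ¬ cs.IsLeftDescent w b := by
  rw [cs.isLeftDescent_iff_not_isLeftDescent_mul, cs.simple_mul_simple_cancel_left]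

/-- All off-diagonal entries of a Coxeter matrix are even, and infinite or at least `6`. -/
def EvenLarge (M : CoxeterMatrix B) : Prop :=
  ∀ i j, i ≠ j → Even (M i j) ∧ (M i j = 0 ∨ 6 ≤ M i j)

/-- In an even Coxeter group, conjugate simple reflections are equal. -/
theorem eq_of_simple_mul_eq_mul_simple (hM : EvenLarge M) {w : W} {b j : B}
    (h : cs.simple b * w = w * cs.simple j) : b = j := by
  classical
  let f : B → Multiplicative (ZMod 2) := fun k => Multiplicative.ofAdd (if k = b then 1 else 0)
  have hsq : ∀ x : Multiplicative (ZMod 2), x ^ 2 = 1 := by decide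
  have hf : M.IsLiftable f := by
    intro i k
    by_cases hik : i = k
    · subst hik
      rw [M.diagonal, pow_one, ← pow_two, hsq]
    · obtain ⟨n, hn⟩ := (hM i k hik).1
      rw [hn, ← two_mul, pow_mul, hsq, one_pow]
  have h2 := congrArg (cs.lift ⟨f, hf⟩) h
  rw [map_mul, map_mul, mul_comm, mul_left_cancel_iff, cs.lift_apply_simple,
    cs.lift_apply_simple] at h2
  simp only [f] at h2
  by_contra hbj
  simp [Ne.symm hbj] at h2

/-- If `w` and `w * s j` lie on different sides of the wall of `s b`, then `b = j`. -/
theorem simple_mul_comm_of_cross (hM : EvenLarge M) {w : W} {b j : B}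
    (h : ¬ (cs.IsLeftDescent w b ↔ cs.IsLeftDescent (w * cs.simple j) b)) :
    b = j ∧ cs.simple b * w = w * cs.simple b := by
  have h1 := simple_mul_eq_mul_simple cs h
  have h2 := eq_of_simple_mul_eq_mul_simple cs hM h1
  subst h2
  exact ⟨rfl, h1⟩

theorem simple_mul_simple_pow_ne_one (hM : EvenLarge M) {x y : B} (hxy : x ≠ y) {n : ℕ}
    (hn : 0 < n) (hnM : M x y = 0 ∨ n < M x y) : (cs.simple x * cs.simple y) ^ n ≠ 1 := by
  classical
  set m := M x y with hm
  let f : B → DihedralGroup m := fun k => if k = x then .sr 0 else if k = y then .sr 1 else 1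
  have hfx : f x = .sr 0 := by simp [f]
  have hfy : f y = .sr 1 := by simp [f, hxy.symm]
  have hsq : ∀ i, f i * f i = 1 := by
    intro i
    simp only [f]
    split_ifs <;> simp
  have hfo : ∀ i, i ≠ x → i ≠ y → f i = 1 := by
    intro i hi hi'
    simp [f, hi, hi']
  have hf : M.IsLiftable f := by
    intro i k
    by_cases hik : i = k
    · subst hik
      rw [M.diagonal, pow_one, hsq]
    · have hev : ∀ g : DihedralGroup m, g * g = 1 → g ^ (M i k) = 1 := by
        intro g hg
        obtain ⟨n, hn⟩ := (hM i k hik).1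
        rw [hn, ← two_mul, pow_mul, pow_two, hg, one_pow]
      by_cases hi : i ≠ x ∧ i ≠ y
      · rw [hfo i hi.1 hi.2, one_mul]; exact hev _ (hsq k)
      by_cases hk : k ≠ x ∧ k ≠ y
      · rw [hfo k hk.1 hk.2, mul_one]; exact hev _ (hsq i)
      have h2 : (i = x ∧ k = y) ∨ (i = y ∧ k = x) := by
        by_cases h3 : i = x <;> by_cases h4 : k = x <;> by_cases h5 : i = y <;>
          by_cases h6 : k = y <;> simp_all
      rcases h2 with ⟨rfl, rfl⟩ | ⟨rfl, rfl⟩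
      · rw [hfx, hfy, DihedralGroup.sr_mul_sr, DihedralGroup.r_pow, ← hm]
        simp
      · rw [hfx, hfy, DihedralGroup.sr_mul_sr, DihedralGroup.r_pow, M.symmetric, ← hm]
        simp
  intro h
  have h2 := congrArg (cs.lift ⟨f, hf⟩) h
  rw [map_pow, map_mul, cs.lift_apply_simple, cs.lift_apply_simple] at h2
  simp only [hfx, hfy] at h2
  rw [DihedralGroup.sr_mul_sr, DihedralGroup.r_pow, map_one, DihedralGroup.one_def] at h2
  have h3 : ((n : ℕ) : ZMod m) = 0 := by
    injection h2 with h2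
    simpa using h2
  rw [ZMod.natCast_eq_zero_iff] at h3
  rcases hnM with h0 | h0
  · rw [h0, zero_dvd_iff] at h3; omega
  · exact absurd (Nat.le_of_dvd hn h3) (by omega)

/-- The alternating product `s x * s y * s x * ⋯` with `n` factors. -/
def altProd (x y : B) : ℕ → W
  | 0 => 1
  | n + 1 => cs.simple x * altProd y x n

theorem altProd_succ (x y : B) (n : ℕ) :
    altProd cs x y (n + 1) = cs.simple x * altProd cs y x n := by
  rw [altProd]

theorem altProd_two_mul (x y : B) (n : ℕ) :
    altProd cs x y (2 * n) = (cs.simple x * cs.simple y) ^ n := by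
  induction n with
  | zero => simp [altProd]
  | succ n ih => rw [mul_add_one, altProd_succ, altProd_succ, ih, pow_succ', mul_assoc]

theorem altProd_coxeter (hM : EvenLarge M) {x y : B} (hxy : x ≠ y) :
    altProd cs x y (M x y) = altProd cs y x (M x y) := by
  obtain ⟨n, hn⟩ := (hM x y hxy).1
  have h := cs.simple_mul_simple_pow x y
  rw [hn, pow_add] at h
  rw [hn, ← two_mul, altProd_two_mul, altProd_two_mul, eq_inv_of_mul_eq_one_left h, ← inv_pow,
    mul_inv_rev, cs.inv_simple, cs.inv_simple]

/-- `z` has minimal length in its coset of the rank two parabolic subgroup of `x, y`. -/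
def IsMinDihedral (x y : B) (z : W) : Prop :=
  ∀ d ∈ Subgroup.closure ({cs.simple x, cs.simple y} : Set W), cs.length z ≤ cs.length (d * z)

theorem IsMinDihedral.symm {x y : B} {z : W} (h : IsMinDihedral cs x y z) :
    IsMinDihedral cs y x z := by
  unfold IsMinDihedral
  rw [Set.pair_comm]; exact h

theorem sep_altProd_mul (hM : EvenLarge M) {z : W} (n : ℕ) :
    ∀ {x y : B} (k : ℕ), x ≠ y → IsMinDihedral cs x y z → (M x y = 0 ∨ n + k < M x y) →
      sep cs ((cs.simple y * cs.simple x) ^ k * cs.simple y) (altProd cs x y n * z) = 0 := by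
  classical
  induction n with
  | zero =>
    intro x y k hxy hz hk
    rw [altProd, one_mul]
    by_contra h0
    have h1 : sep cs ((cs.simple y * cs.simple x) ^ k * cs.simple y) z = 1 := by
      generalize sep cs ((cs.simple y * cs.simple x) ^ k * cs.simple y) z = a at h0
      revert a; decide
    have hx : cs.simple x ∈ Subgroup.closure ({cs.simple x, cs.simple y} : Set W) :=
      Subgroup.subset_closure (by simp)
    have hy : cs.simple y ∈ Subgroup.closure ({cs.simple x, cs.simple y} : Set W) :=
      Subgroup.subset_closure (by simp)
    have := hz _ (mul_mem (pow_mem (mul_mem hy hx) k) hy)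
    have := length_mul_lt_of_sep cs _ _ h1
    omega
  | succ n ih =>
    intro x y k hxy hz hk
    rw [altProd_succ, mul_assoc, sep_simple_mul]
    have h1 : cs.simple x * ((cs.simple y * cs.simple x) ^ k * cs.simple y) * cs.simple x =
        (cs.simple x * cs.simple y) ^ (k + 1) * cs.simple x := by
      have : ∀ k : ℕ, cs.simple x * (cs.simple y * cs.simple x) ^ k =
          (cs.simple x * cs.simple y) ^ k * cs.simple x := by
        intro k
        induction k with
        | zero => simp
        | succ k ih2 =>
          rw [pow_succ', ← mul_assoc, ← mul_assoc, mul_assoc _ _ (_ ^ k), ih2, pow_succ']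
          group
      rw [← mul_assoc, this, pow_succ]; group
    rw [h1, ih (k + 1) hxy.symm hz.symm (by rw [M.symmetric]; omega), add_zero, if_neg]
    intro h2
    refine simple_mul_simple_pow_ne_one cs hM hxy.symm (Nat.succ_pos k)
      (by rw [M.symmetric]; omega) ?_
    rw [pow_succ, ← mul_assoc, h2, cs.simple_mul_simple_self]

theorem not_isLeftDescent_altProd (hM : EvenLarge M) {x y : B} (hxy : x ≠ y) {z : W}
    (hz : IsMinDihedral cs x y z) {n : ℕ} (hn : M x y = 0 ∨ n < M x y) :
    ¬ cs.IsLeftDescent (altProd cs x y n * z) y := by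
  have := sep_altProd_mul cs hM n 0 hxy hz hn
  rw [pow_zero, one_mul] at this
  rw [isLeftDescent_iff_sep, this]
  decide

theorem isLeftDescent_altProd (hM : EvenLarge M) {x y : B} (hxy : x ≠ y) {z : W}
    (hz : IsMinDihedral cs x y z) {n : ℕ} (hn : M x y = 0 ∨ n < M x y) :
    cs.IsLeftDescent (altProd cs x y (n + 1) * z) x := by
  rw [altProd_succ, mul_assoc, isLeftDescent_simple_mul]
  exact not_isLeftDescent_altProd cs hM hxy.symm hz.symm (by rwa [M.symmetric])

theorem length_altProd_mul (hM : EvenLarge M) {z : W} (n : ℕ) :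
    ∀ {x y : B}, x ≠ y → IsMinDihedral cs x y z → (M x y = 0 ∨ n ≤ M x y) →
      cs.length (altProd cs x y n * z) = n + cs.length z := by
  induction n with
  | zero => intros; simp [altProd]
  | succ n ih =>
    intro x y hxy hz hn
    have h1 := isLeftDescent_altProd cs hM hxy hz (n := n) hn
    rw [cs.isLeftDescent_iff] at h1
    have h2 := ih hxy.symm hz.symm (by rw [M.symmetric]; omega)
    rw [altProd_succ, mul_assoc] at h1 ⊢
    rw [cs.simple_mul_simple_cancel_left, h2] at h1
    omega

theorem exists_altProd_eq (hM : EvenLarge M) {x y : B} (hxy : x ≠ y) {d : W}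
    (hd : d ∈ Subgroup.closure ({cs.simple x, cs.simple y} : Set W)) :
    ∃ n, (M x y = 0 ∨ n ≤ M x y) ∧ (d = altProd cs x y n ∨ d = altProd cs y x n) := by
  have key : ∀ x y : B, x ≠ y → ∀ d : W,
      (∃ n, (M x y = 0 ∨ n ≤ M x y) ∧ (d = altProd cs x y n ∨ d = altProd cs y x n)) →
      (∃ n, (M x y = 0 ∨ n ≤ M x y) ∧ (cs.simple x * d = altProd cs x y n ∨
        cs.simple x * d = altProd cs y x n)) := by
    rintro x y hxy d ⟨n, hn, h⟩
    have h1 : d = altProd cs x y n → (∃ n, (M x y = 0 ∨ n ≤ M x y) ∧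
        (cs.simple x * d = altProd cs x y n ∨ cs.simple x * d = altProd cs y x n)) := by
      rintro rfl
      cases n with
      | zero => exact ⟨1, by have := hM x y hxy; omega, Or.inl (by simp [altProd])⟩
      | succ n =>
        refine ⟨n, by omega, Or.inr ?_⟩
        rw [altProd_succ, cs.simple_mul_simple_cancel_left]
    rcases h with h | h
    · exact h1 h
    · by_cases hnm : n = M x y
      · refine h1 ?_
        rw [h, hnm, altProd_coxeter cs hM hxy]
      · exact ⟨n + 1, by omega, Or.inl (by rw [h, altProd_succ])⟩
  induction hd using Subgroup.closure_induction_left with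
  | one => exact ⟨0, by simp, Or.inl (by simp [altProd])⟩
  | mul_left a ha d hd ih =>
    rcases ha with rfl | rfl
    · exact key x y hxy d ih
    · obtain ⟨n, hn, h⟩ := key y x hxy.symm d (by
        obtain ⟨n, hn, h⟩ := ih; exact ⟨n, by rwa [M.symmetric], h.symm⟩)
      exact ⟨n, by rwa [M.symmetric], h.symm⟩
  | inv_mul_cancel a ha d hd ih =>
    rcases ha with rfl | rfl
    · rw [cs.inv_simple]; exact key x y hxy d ih
    · rw [cs.inv_simple]
      obtain ⟨n, hn, h⟩ := key y x hxy.symm d (by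
        obtain ⟨n, hn, h⟩ := ih; exact ⟨n, by rwa [M.symmetric], h.symm⟩)
      exact ⟨n, by rwa [M.symmetric], h.symm⟩

theorem exists_isMinDihedral (x y : B) (u : W) :
    ∃ d ∈ Subgroup.closure ({cs.simple x, cs.simple y} : Set W), ∃ z, u = d * z ∧
      IsMinDihedral cs x y z := by
  classical
  set H := Subgroup.closure ({cs.simple x, cs.simple y} : Set W)
  have hex : ∃ n, ∃ d ∈ H, cs.length (d * u) = n := ⟨_, 1, one_mem _, rfl⟩
  obtain ⟨d, hd, hl⟩ := Nat.find_spec hex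
  refine ⟨d⁻¹, inv_mem hd, d * u, by group, fun d' hd' => ?_⟩
  rw [hl]
  exact Nat.find_min' hex ⟨d' * d, mul_mem hd' hd, by rw [mul_assoc]⟩

/-- An element with two left descents starts with the longest element of the
corresponding rank two parabolic subgroup. -/
theorem exists_eq_altProd_mul (hM : EvenLarge M) {x y : B} (hxy : x ≠ y) {u : W}
    (hx : cs.IsLeftDescent u x) (hy : cs.IsLeftDescent u y) :
    M x y ≠ 0 ∧ ∃ z, IsMinDihedral cs x y z ∧ u = altProd cs x y (M x y) * z := by
  obtain ⟨d, hd, z, rfl, hz⟩ := exists_isMinDihedral cs x y u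
  obtain ⟨n, hn, h⟩ := exists_altProd_eq cs hM hxy hd
  by_cases hn' : M x y = 0 ∨ n < M x y
  · exfalso
    rcases h with rfl | rfl
    · exact not_isLeftDescent_altProd cs hM hxy hz hn' hy
    · exact not_isLeftDescent_altProd cs hM hxy.symm hz.symm (by rwa [M.symmetric]) hx
  · obtain ⟨h0, h1⟩ := not_or.1 hn'
    have : n = M x y := by omega
    subst this
    refine ⟨h0, z, hz, ?_⟩
    rcases h with rfl | rfl
    · rfl
    · rw [altProd_coxeter cs hM hxy]

theorem le_length_of_isLeftDescent (hM : EvenLarge M) {x y : B} (hxy : x ≠ y) {u : W}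
    (hx : cs.IsLeftDescent u x) (hy : cs.IsLeftDescent u y) :
    M x y ≠ 0 ∧ M x y ≤ cs.length u := by
  obtain ⟨h0, z, hz, rfl⟩ := exists_eq_altProd_mul cs hM hxy hx hy
  rw [length_altProd_mul cs hM _ hxy hz (Or.inr le_rfl)]
  exact ⟨h0, by omega⟩

/-- Stripping letters alternately from an element with two left descents. -/
theorem isLeftDescent_strip (hM : EvenLarge M) {x y : B} (hxy : x ≠ y) {u : W}
    (hx : cs.IsLeftDescent u x) (hy : cs.IsLeftDescent u y) :
    cs.IsLeftDescent (cs.simple x * u) y ∧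
    cs.IsLeftDescent (cs.simple y * (cs.simple x * u)) x ∧
    cs.IsLeftDescent (cs.simple x * (cs.simple y * (cs.simple x * u))) y ∧
    cs.IsLeftDescent (cs.simple y * (cs.simple x * (cs.simple y * (cs.simple x * u)))) x := by
  obtain ⟨h0, z, hz, rfl⟩ := exists_eq_altProd_mul cs hM hxy hx hy
  have h6 := hM x y hxy
  obtain ⟨n, hn⟩ : ∃ n, M x y = n + 5 := ⟨M x y - 5, by omega⟩
  have hn' : M y x = n + 5 := by rw [M.symmetric]; exact hn
  rw [hn]
  simp only [altProd_succ cs x y (n + 4), altProd_succ cs y x (n + 3), altProd_succ cs x y (n + 2),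
    altProd_succ cs y x (n + 1), mul_assoc, cs.simple_mul_simple_cancel_left]
  refine ⟨?_, ?_, ?_, ?_⟩
  · have := isLeftDescent_altProd cs hM hxy.symm hz.symm (n := n + 3) (by omega)
    rwa [altProd_succ, altProd_succ, altProd_succ, mul_assoc, mul_assoc, mul_assoc] at this
  · have := isLeftDescent_altProd cs hM hxy hz (n := n + 2) (by omega)
    rwa [altProd_succ, altProd_succ, mul_assoc, mul_assoc] at this
  · have := isLeftDescent_altProd cs hM hxy.symm hz.symm (n := n + 1) (by omega)
    rwa [altProd_succ, mul_assoc] at this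
  · exact isLeftDescent_altProd cs hM hxy hz (n := n) (by omega)

theorem isLeftDescent_unique (hM : EvenLarge M) (n : ℕ) : ∀ {i k l : B} {x : W},
    cs.length x ≤ n → cs.IsLeftDescent x i → cs.IsLeftDescent x k → i ≠ k →
    cs.IsLeftDescent (cs.simple i * x) l → l = k := by
  induction n with
  | zero =>
    intro i k l x hn hi
    unfold IsLeftDescent at hi; omega
  | succ n ih =>
    intro i k l x hn hi hk hik hl
    by_contra hlk
    obtain ⟨h1, h2, -, -⟩ := isLeftDescent_strip cs hM hik hi hk
    have : i = l := ih (x := cs.simple i * x) (by unfold IsLeftDescent at hi; omega) h1 hl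
      (Ne.symm hlk) h2
    subst this
    exact isLeftDescent_simple_mul cs |>.1 hl hi

/-- An element has at most two left descents. -/
theorem isLeftDescent_two (hM : EvenLarge M) {i k l : B} {x : W}
    (hi : cs.IsLeftDescent x i) (hk : cs.IsLeftDescent x k) (hl : cs.IsLeftDescent x l)
    (hik : i ≠ k) : l = i ∨ l = k := by
  by_cases h : l = i
  · exact Or.inl h
  · exact Or.inr (isLeftDescent_unique cs hM _ le_rfl hi hk hik
      (isLeftDescent_strip cs hM (Ne.symm h) hi hl).1)

theorem isLeftDescent_simple_mul_adjacent {b l : B} {u : W} (hb : ¬ cs.IsLeftDescent u b)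
    (hu : cs.simple b * u = u * cs.simple b) (hl : cs.IsLeftDescent u l) :
    cs.IsLeftDescent (cs.simple b * u) l := by
  have h1 := cs.length_mul_le (cs.simple l * u) (cs.simple b)
  rw [cs.length_simple] at h1
  rw [cs.not_isLeftDescent_iff] at hb
  unfold IsLeftDescent at *
  rw [hu, ← mul_assoc, ← hu]
  omega

/-- Stripping the left descent of an element adjacent to the wall of `s b` leaves `b` as the
only possible left descent. -/
theorem isLeftDescent_adjacent_next (hM : EvenLarge M) {b l l' : B} {u : W}
    (hb : ¬ cs.IsLeftDescent u b) (hu : cs.simple b * u = u * cs.simple b)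
    (hl : cs.IsLeftDescent u l) (hl' : cs.IsLeftDescent (cs.simple l * u) l') : l' = b := by
  have hlb : l ≠ b := by rintro rfl; exact hb hl
  obtain ⟨-, h2, h3, -⟩ := isLeftDescent_strip cs hM hlb.symm
    ((isLeftDescent_simple_mul cs).2 hb) (isLeftDescent_simple_mul_adjacent cs hb hu hl)
  rw [cs.simple_mul_simple_cancel_left] at h2 h3
  by_contra hne
  have : l = l' := isLeftDescent_unique cs hM _ le_rfl h2 hl' (Ne.symm hne) h3
  subst this
  exact (isLeftDescent_simple_mul cs).1 hl' hl

end Coxeter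

section Walks

variable {B W : Type*} [Group W] {M : CoxeterMatrix B} (cs : CoxeterSystem M W) (pos : B → ℤ)

open CoxeterSystem

/-- The edges of the graph on `W × ℤ`: vertical moves inside a line `{w} × ℤ`, and crossings
from `w` to `w * s j` at height `pos j`. -/
def Step (p q : W × ℤ) : Prop :=
  (q.1 = p.1 ∧ (q.2 = p.2 + 1 ∨ p.2 = q.2 + 1)) ∨
    ∃ j, p.2 = pos j ∧ q.2 = pos j ∧ q.1 = p.1 * cs.simple j

/-- `Conn L p q`: there is a walk of length `L` from `p` to `q`. -/
inductive Conn : ℕ → W × ℤ → W × ℤ → Prop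
  | refl (p) : Conn 0 p p
  | cons {L : ℕ} {p q r : W × ℤ} : Step cs pos p q → Conn L q r → Conn (L + 1) p r

variable {cs pos}

theorem Step.symm {p q : W × ℤ} (h : Step cs pos p q) : Step cs pos q p := by
  rcases h with ⟨h1, h2⟩ | ⟨j, h1, h2, h3⟩
  · exact Or.inl ⟨h1.symm, h2.symm⟩
  · exact Or.inr ⟨j, h2, h1, by rw [h3, cs.simple_mul_simple_cancel_right]⟩

theorem Step.smul {p q : W × ℤ} (h : Step cs pos p q) (u : W) :
    Step cs pos (u * p.1, p.2) (u * q.1, q.2) := by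
  rcases h with ⟨h1, h2⟩ | ⟨j, h1, h2, h3⟩
  · exact Or.inl ⟨by rw [h1], h2⟩
  · exact Or.inr ⟨j, h1, h2, by rw [h3, mul_assoc]⟩

theorem Conn.single {p q : W × ℤ} (h : Step cs pos p q) : Conn cs pos 1 p q :=
  Conn.cons h (Conn.refl _)

theorem Conn.trans {L L' : ℕ} {p q r : W × ℤ} (h : Conn cs pos L p q) (h' : Conn cs pos L' q r) :
    Conn cs pos (L + L') p r := by
  induction h with
  | refl p => rwa [zero_add]
  | cons hs _ ih => rw [Nat.add_right_comm]; exact Conn.cons hs (ih h')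

theorem Conn.symm {L : ℕ} {p q : W × ℤ} (h : Conn cs pos L p q) : Conn cs pos L q p := by
  induction h with
  | refl p => exact Conn.refl _
  | cons hs _ ih => exact ih.trans (Conn.single hs.symm)

theorem Conn.smul {L : ℕ} {p q : W × ℤ} (h : Conn cs pos L p q) (u : W) :
    Conn cs pos L (u * p.1, p.2) (u * q.1, q.2) := by
  induction h with
  | refl p => exact Conn.refl _
  | cons hs _ ih => exact Conn.cons (hs.smul u) ih

theorem Conn.exists_last {L : ℕ} {p q : W × ℤ} (h : Conn cs pos (L + 1) p q) :
    ∃ r, Conn cs pos L p r ∧ Step cs pos r q := by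
  have h := h.symm
  cases h with
  | cons hs h => exact ⟨_, h.symm, hs.symm⟩

theorem Conn.travel (w : W) (n m : ℤ) : Conn cs pos (n - m).natAbs (w, n) (w, m) := by
  have key : ∀ k : ℕ, ∀ n : ℤ, Conn cs pos k (w, n) (w, n + k) := by
    intro k
    induction k with
    | zero => intro n; simpa using Conn.refl (w, n)
    | succ k ih =>
      intro n
      refine Conn.cons (q := (w, n + 1)) (Or.inl ⟨rfl, Or.inl rfl⟩) ?_
      convert ih (n + 1) using 2
      push_cast; ring
  rcases le_total n m with h | h
  · convert key (n - m).natAbs n using 2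
    omega
  · convert (key (n - m).natAbs m).symm using 2
    omega

theorem Conn.natAbs_le {L : ℕ} {p q : W × ℤ} (h : Conn cs pos L p q) :
    (p.2 - q.2).natAbs ≤ L := by
  induction h with
  | refl p => simp
  | cons hs _ ih =>
    rcases hs with ⟨h1, h2⟩ | ⟨j, h1, h2, h3⟩ <;> omega

theorem Step.length_le {p q : W × ℤ} (h : Step cs pos p q) :
    cs.length q.1 ≤ cs.length p.1 + 1 := by
  rcases h with ⟨h1, h2⟩ | ⟨j, h1, h2, h3⟩
  · rw [h1]; omega
  · rw [h3, ← cs.length_simple j]; exact cs.length_mul_le _ _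

theorem Conn.length_le {L : ℕ} {p q : W × ℤ} (h : Conn cs pos L p q) :
    cs.length q.1 ≤ cs.length p.1 + L := by
  induction h with
  | refl p => simp
  | cons hs _ ih => have := hs.length_le; omega

theorem Conn.cross {L : ℕ} {p : W × ℤ} {j : B} (h : Conn cs pos L p (cs.simple j, pos j)) :
    Conn cs pos (L + 1) p (1, pos j) :=
  h.trans (Conn.single (Or.inr ⟨j, rfl, rfl, by simp⟩))

theorem Step.eq_of_cross (hM : EvenLarge M) {p q : W × ℤ} (h : Step cs pos p q) {b : B}
    (hb : ¬ (cs.IsLeftDescent p.1 b ↔ cs.IsLeftDescent q.1 b)) :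
    p.2 = pos b ∧ q.2 = pos b ∧ q.1 = p.1 * cs.simple b ∧
      cs.simple b * p.1 = p.1 * cs.simple b := by
  rcases h with ⟨h1, h2⟩ | ⟨j, h1, h2, h3⟩
  · rw [h1] at hb; exact absurd Iff.rfl hb
  · rw [h3] at hb
    obtain ⟨rfl, h4⟩ := simple_mul_comm_of_cross cs hM hb
    exact ⟨h1, h2, h3, h4⟩

/-- A walk leaving the negative side of the wall of `s b`, decomposed at its first crossing. -/
theorem Conn.exists_cross (hM : EvenLarge M) {L : ℕ} {p q : W × ℤ} (h : Conn cs pos L p q) {b : B}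
    (hp : cs.IsLeftDescent p.1 b) (hq : ¬ cs.IsLeftDescent q.1 b) :
    ∃ u L₁ L₂, L₁ + 1 + L₂ = L ∧ Conn cs pos L₁ (cs.simple b * p.1, p.2) (u, pos b) ∧
      ¬ cs.IsLeftDescent u b ∧ cs.simple b * u = u * cs.simple b ∧
      Conn cs pos L₂ (u, pos b) q := by
  induction h with
  | refl p => exact absurd hp hq
  | @cons L p p' q hs h ih =>
    by_cases hp' : cs.IsLeftDescent p'.1 b
    · obtain ⟨u, L₁, L₂, hL, h1, h2, h3, h4⟩ := ih hp' hq
      exact ⟨u, L₁ + 1, L₂, by omega, Conn.cons (hs.smul _) h1, h2, h3, h4⟩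
    · obtain ⟨h1, h2, h3, h4⟩ := hs.eq_of_cross hM (b := b) (by tauto)
      refine ⟨p'.1, 0, L, by omega, ?_, hp', ?_, ?_⟩
      · rw [h3, h4, h1]; exact Conn.refl _
      · rw [h3, ← h4, cs.simple_mul_simple_cancel_left, h4, cs.simple_mul_simple_cancel_right]
      · rw [← h2]; exact h

theorem Conn.fold (hM : EvenLarge M) {L : ℕ} {p q : W × ℤ} (h : Conn cs pos L p q) {b : B}
    (hp : cs.IsLeftDescent p.1 b) (hq : ¬ cs.IsLeftDescent q.1 b) :
    ∃ L' < L, Conn cs pos L' (cs.simple b * p.1, p.2) q := by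
  obtain ⟨u, L₁, L₂, hL, h1, -, -, h4⟩ := h.exists_cross hM hp hq
  exact ⟨L₁ + L₂, by omega, h1.trans h4⟩

theorem Conn.exists_cross_avoiding (hM : EvenLarge M) {b c : B} (L : ℕ) : ∀ {p q : W × ℤ},
    Conn cs pos L p q → cs.IsLeftDescent p.1 b → ¬ cs.IsLeftDescent q.1 b →
    ¬ cs.IsLeftDescent p.1 c → ¬ cs.IsLeftDescent q.1 c →
    ∃ u L₁ L₂, L₁ + 1 + L₂ ≤ L ∧ Conn cs pos L₁ (cs.simple b * p.1, p.2) (u, pos b) ∧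
      ¬ cs.IsLeftDescent u b ∧ cs.simple b * u = u * cs.simple b ∧
      ¬ cs.IsLeftDescent u c ∧ Conn cs pos L₂ (u, pos b) q := by
  induction L using Nat.strong_induction_on with
  | _ L ih =>
    intro p q h hp hq hpc hqc
    obtain ⟨u, L₁, L₂, hL, h1, h2, h3, h4⟩ := h.exists_cross hM hp hq
    by_cases huc : cs.IsLeftDescent u c
    · have h5 : Conn cs pos (L₁ + 1) p (u, pos b) := by
        have h6 := h1.smul (cs.simple b)
        simp only [cs.simple_mul_simple_cancel_left] at h6
        exact h6.trans (Conn.single (Or.inr ⟨b, rfl, rfl, by simp [h3]⟩))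
      obtain ⟨L₃, hL3, h6⟩ := h5.symm.fold hM huc hpc
      obtain ⟨L₄, hL4, h7⟩ := h4.fold hM huc hqc
      obtain ⟨u', M₁, M₂, hL', h⟩ := ih (L₃ + L₄) (by omega) (h6.symm.trans h7) hp hq hpc hqc
      exact ⟨u', M₁, M₂, by omega, h⟩
    · exact ⟨u, L₁, L₂, hL.le, h1, h2, h3, huc, h4⟩

/-- A walk to the wall of `s b` from a point close to it can be redirected to the
point of the wall adjacent to `1`. -/
theorem Conn.exists_to_one (hM : EvenLarge M) (L : ℕ) : ∀ {b : B} {x y : W} {n : ℤ},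
    ¬ cs.IsLeftDescent x b →
    (∀ l, cs.IsLeftDescent x l → ¬ cs.IsLeftDescent (cs.simple l * x) b) →
    ¬ cs.IsLeftDescent y b → cs.simple b * y = y * cs.simple b →
    Conn cs pos L (x, n) (y, pos b) → ∃ L' ≤ L, Conn cs pos L' (x, n) (1, pos b) := by
  induction L using Nat.strong_induction_on with
  | _ L ih =>
    intro b x y n hxb hx hyb hy h
    by_cases hy1 : y = 1
    · subst hy1; exact ⟨L, le_rfl, h⟩
    obtain ⟨l, hl⟩ := cs.exists_leftDescent_of_ne_one hy1
    have hlb : l ≠ b := by rintro rfl; exact hyb hl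
    obtain ⟨-, d1, d2, d3⟩ := isLeftDescent_strip cs hM hlb.symm
      ((isLeftDescent_simple_mul cs).2 hyb) (isLeftDescent_simple_mul_adjacent cs hyb hy hl)
    rw [cs.simple_mul_simple_cancel_left] at d1 d2 d3
    by_cases hxl : cs.IsLeftDescent x l
    · have hx0l : ¬ cs.IsLeftDescent (cs.simple l * x) l := by
        rw [isLeftDescent_simple_mul]; exact not_not.2 hxl
      have hyl : ¬ cs.IsLeftDescent (cs.simple l * y) l := by
        rw [isLeftDescent_simple_mul]; exact not_not.2 hl
      have hyb' : ¬ cs.IsLeftDescent (cs.simple b * (cs.simple l * y)) b := by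
        rw [isLeftDescent_simple_mul]; exact not_not.2 d1
      obtain ⟨u₁, L₁, L₂, hL, h1, h2, h3, h4, h5⟩ :=
        (h.symm.smul (cs.simple l)).exists_cross_avoiding
        hM (b := b) (c := l) L d1 (hx l hxl) hyl hx0l
      obtain ⟨u₂, L₁₁, L₁₂, hL1, h6, h7, h8, h9, h10⟩ :=
        h1.exists_cross_avoiding hM (b := l) (c := b) L₁ d2 h4 hyb' h2
      obtain ⟨u₃, K₁, K₂, hK, -, -, -, h11⟩ := h6.exists_cross hM (b := b) d3 h9
      have h12 := h11.natAbs_le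
      obtain ⟨L', hL', h13⟩ := ih L₁₂ (by omega) (b := l) h4
        (fun l' hl' hl'' => hlb (isLeftDescent_adjacent_next cs hM h2 h3 hl' hl'')) h7 h8 h10.symm
      have h14 := (h5.symm.trans h13).smul (cs.simple l)
      simp only [cs.simple_mul_simple_cancel_left, mul_one] at h14
      refine ⟨_, ?_, h14.cross.trans (Conn.travel 1 (pos l) (pos b))⟩
      simp only at h12
      omega
    · obtain ⟨L', hL', h1⟩ := h.symm.fold hM (b := l) hl hxl
      obtain ⟨u, L₁, L₂, hL, -, h2, h3, h4⟩ := h1.exists_cross hM (b := b) d1 hxb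
      obtain ⟨L'', hL'', h5⟩ := ih L₂ (by omega) hxb hx h2 h3 h4.symm
      exact ⟨L'', by omega, h5⟩

theorem Conn.exists_altProd_to_one (hM : EvenLarge M) (j : ℕ) : ∀ {x y : B} {z q : W} {n c : ℤ}
    {L : ℕ}, x ≠ y → IsMinDihedral cs x y z → (M x y = 0 ∨ j + 1 < M x y) →
    (∀ l, cs.IsLeftDescent z l →
      ¬ cs.IsLeftDescent (cs.simple l * z) (if Even j then x else y)) →
    Conn cs pos L (altProd cs x y (j + 1) * z, n) (q, c) →
    ¬ cs.IsLeftDescent q x → ¬ cs.IsLeftDescent q y →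
    ∃ L', L' + (c - pos x).natAbs ≤ L ∧
      Conn cs pos L' (altProd cs x y (j + 1) * z, n) (1, pos x) := by
  induction j with
  | zero =>
    intro x y z q n c L hxy hz hm hl h hqx hqy
    rw [altProd_succ, altProd, mul_one] at h ⊢
    have hzx : ¬ cs.IsLeftDescent z x := by
      have := not_isLeftDescent_altProd cs hM hxy.symm hz.symm (n := 0)
        (by rw [M.symmetric]; omega)
      rwa [altProd, one_mul] at this
    obtain ⟨u, L₁, L₂, hL, h1, h2, h3, h4⟩ := h.exists_cross hM (b := x)
      ((isLeftDescent_simple_mul cs).2 hzx) hqx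
    simp only [cs.simple_mul_simple_cancel_left] at h1
    obtain ⟨L', hL', h5⟩ := Conn.exists_to_one hM L₁ hzx (by simpa using hl) h2 h3 h1
    have h6 := h5.smul (cs.simple x)
    simp only [mul_one] at h6
    have h7 := h4.natAbs_le
    simp only at h7
    exact ⟨L' + 1, by omega, h6.cross⟩
  | succ j ih =>
    intro x y z q n c L hxy hz hm hl h hqx hqy
    have hpx := isLeftDescent_altProd cs hM hxy hz (n := j + 1) (by omega)
    have hpy := not_isLeftDescent_altProd cs hM hxy hz (n := j + 1 + 1) (by omega)
    obtain ⟨u, L₁, L₂, hL, h1, h2, h3, h4, h5⟩ :=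
      h.exists_cross_avoiding hM (b := x) (c := y) L hpx hqx hpy hqy
    rw [altProd_succ, mul_assoc, cs.simple_mul_simple_cancel_left] at h1
    obtain ⟨L', hL', h6⟩ := ih hxy.symm hz.symm (by rw [M.symmetric]; omega)
      (by
        intro l hl'
        have := hl l hl'
        by_cases hj : Even j <;> simpa [Nat.even_add_one, hj] using this) h1 h4 h2
    have h7 := h6.smul (cs.simple x)
    simp only [mul_one] at h7
    have h8 := h5.natAbs_le
    simp only at h8
    have h9 := (h7.trans (Conn.travel _ (pos y) (pos x))).cross
    rw [← mul_assoc, ← altProd_succ] at h9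
    exact ⟨_, by omega, h9⟩

theorem altProd_even_succ_right (x y : B) (n : ℕ) :
    altProd cs x y (2 * n + 2) = altProd cs x y (2 * n + 1) * cs.simple y := by
  rw [altProd_succ, altProd_succ, altProd_succ, altProd_two_mul, altProd_two_mul, mul_assoc,
    mul_left_cancel_iff]
  induction n with
  | zero => simp
  | succ n ih =>
    rw [pow_succ', pow_succ', ← mul_assoc, ← mul_assoc, mul_assoc _ (cs.simple y), ih, ← mul_assoc]

/-- Along a walk shorter than the distance to the base line, descents only change in a
controlled way. -/
theorem Conn.descent_of_lt (hM : EvenLarge M) {D L : ℕ} {w w' : W} {n n' : ℤ}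
    (hD : ∀ K m, Conn cs pos K (w, n) (1, m) → D ≤ K) (hL : L < D)
    (h : Conn cs pos L (w, n) (w', n')) {i : B} (hi : cs.IsLeftDescent w i) :
    cs.IsLeftDescent w' i ∨ ∃ k, k ≠ i ∧ M i k ≠ 0 ∧ M i k ≤ cs.length w + L ∧
      cs.IsLeftDescent w' k := by
  by_contra hcon
  rw [not_or] at hcon
  obtain ⟨hi', hcon⟩ := hcon
  obtain ⟨u, L₁, L₂, hL', h1, h2, h3, h4⟩ := h.exists_cross hM (b := i) hi hi'
  have h1' := h1.smul (cs.simple i)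
  simp only [cs.simple_mul_simple_cancel_left] at h1'
  by_cases hu : u = 1
  · subst hu
    rw [mul_one] at h1'
    have := hD _ _ h1'.cross
    omega
  obtain ⟨k, hk⟩ := cs.exists_leftDescent_of_ne_one hu
  have hki : k ≠ i := by rintro rfl; exact h2 hk
  have hv := (isLeftDescent_simple_mul cs).2 h2
  have hvk := isLeftDescent_simple_mul_adjacent cs h2 h3 hk
  obtain ⟨h0, hle⟩ := le_length_of_isLeftDescent cs hM hki.symm hv hvk
  have hlen := h1'.length_le
  simp only at hlen
  have hkw : ¬ cs.IsLeftDescent w' k := fun hkw => hcon ⟨k, hki, h0, by omega, hkw⟩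
  obtain ⟨-, z, hz, hvz⟩ := exists_eq_altProd_mul cs hM hki.symm hv hvk
  obtain ⟨hev, h6⟩ := hM i k hki.symm
  obtain ⟨r, hr⟩ : ∃ r, M i k = 2 * r + 2 := by
    obtain ⟨r, hr⟩ := hev; exact ⟨r - 1, by omega⟩
  have hur : u = altProd cs k i (2 * r + 1) * z := by
    rw [hr, altProd_succ, mul_assoc, mul_left_cancel_iff] at hvz
    exact hvz
  have hzi : cs.simple i * z = z * cs.simple i := by
    have h7 : altProd cs k i (2 * r + 1) * (cs.simple i * z) =
        altProd cs k i (2 * r + 1) * (z * cs.simple i) := by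
      rw [← mul_assoc, ← mul_assoc, ← hur, ← h3, hvz, altProd_coxeter cs hM hki.symm, hr,
        altProd_even_succ_right]
    exact mul_left_cancel h7
  have hzni : ¬ cs.IsLeftDescent z i := by
    have := not_isLeftDescent_altProd cs hM hki hz.symm (n := 0) (by rw [M.symmetric]; omega)
    rwa [altProd, one_mul] at this
  rw [hur] at h4
  obtain ⟨L', hL'', h5⟩ := Conn.exists_altProd_to_one hM (2 * r) hki hz.symm
    (by rw [M.symmetric]; omega) (by
      intro l hl hl'
      rw [if_pos (even_two_mul r)] at hl'
      exact hki (isLeftDescent_adjacent_next cs hM hzni hzi hl hl')) h4 hkw hi'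
  rw [← hur] at h5
  have h8 := h1'.trans (Conn.single (q := (u, pos i)) (Or.inr ⟨i, rfl, rfl, by simp [h3]⟩))
  have := hD _ _ (h8.trans h5)
  omega

/-- Equality, or joined by an edge with a label at most `K`. -/
def Close (M : CoxeterMatrix B) (K : ℕ) (i k : B) : Prop := i = k ∨ (M i k ≠ 0 ∧ M i k ≤ K)

theorem close_of_isLeftDescent (hM : EvenLarge M) {K : ℕ} {i k : B} {u : W}
    (hi : cs.IsLeftDescent u i) (hk : cs.IsLeftDescent u k) (hK : cs.length u ≤ K) :
    Close M K i k := by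
  by_cases h : i = k
  · exact Or.inl h
  · obtain ⟨h0, h1⟩ := le_length_of_isLeftDescent cs hM h hi hk
    exact Or.inr ⟨h0, h1.trans hK⟩

theorem Conn.exists_close (hM : EvenLarge M) {D L : ℕ} {w w' : W} {n n' : ℤ}
    (hD : ∀ K m, Conn cs pos K (w, n) (1, m) → D ≤ K) (hw : cs.length w ≤ D) (hL : L ≤ D)
    (h : Conn cs pos L (w, n) (w', n')) {i i' : B} (hi : cs.IsLeftDescent w i)
    (hi' : cs.IsLeftDescent w' i') :
    ∃ k, Close M (2 * D) i k ∧ Close M (2 * D) k i' := by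
  cases L with
  | zero =>
    cases h
    exact ⟨i, Or.inl rfl, close_of_isLeftDescent hM hi hi' (by omega)⟩
  | succ L =>
    obtain ⟨⟨w'', n''⟩, h1, hs⟩ := h.exists_last
    have hlen := h1.length_le
    have hlen' := h.length_le
    simp only at hlen hlen'
    obtain ⟨k, hik, hk⟩ : ∃ k, Close M (2 * D) i k ∧ cs.IsLeftDescent w'' k := by
      rcases h1.descent_of_lt hM hD (by omega) hi with h2 | ⟨k, -, h0, h2, h3⟩
      · exact ⟨i, Or.inl rfl, h2⟩
      · exact ⟨k, Or.inr ⟨h0, by omega⟩, h3⟩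
    refine ⟨k, hik, ?_⟩
    by_cases hk' : cs.IsLeftDescent w' k
    · exact close_of_isLeftDescent hM hk' hi' (by omega)
    · obtain ⟨-, -, h3, h4⟩ := hs.eq_of_cross hM (b := k) (by simp only; tauto)
      simp only at h3 h4
      have h5 : cs.simple k * w' = w' * cs.simple k := by
        rw [h3, ← h4, cs.simple_mul_simple_cancel_left, h4, cs.simple_mul_simple_cancel_right]
      have h6 := isLeftDescent_simple_mul_adjacent cs hk' h5 hi'
      rw [h5, h3, cs.simple_mul_simple_cancel_right] at h6
      exact close_of_isLeftDescent hM hk h6 (by omega)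

theorem Conn.exists_pos_eq (hM : EvenLarge M) {D : ℕ} {w : W} {n m : ℤ}
    (hD : ∀ K m, Conn cs pos K (w, n) (1, m) → D ≤ K) (h : Conn cs pos D (w, n) (1, m))
    (hw : w ≠ 1) : ∃ i, m = pos i ∧ cs.IsLeftDescent w i := by
  cases D with
  | zero => cases h; exact absurd rfl hw
  | succ D =>
    obtain ⟨⟨w', n'⟩, h1, hs⟩ := h.exists_last
    rcases hs with ⟨h2, -⟩ | ⟨j, h2, h3, h4⟩
    · simp only at h2; subst h2
      have := hD _ _ h1; omega
    · simp only at h2 h3 h4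
      have h5 : w' = cs.simple j := by
        rw [← cs.inv_simple]; exact eq_inv_of_mul_eq_one_left h4.symm
      subst h5
      refine ⟨j, h3, ?_⟩
      by_contra hj
      have hjj : cs.IsLeftDescent (cs.simple j) j := by
        unfold IsLeftDescent; simp
      obtain ⟨L', hL', h6⟩ := h1.symm.fold hM (b := j) hjj hj
      simp only [cs.simple_mul_simple_self] at h6
      have := hD _ _ h6.symm; omega

end Walks

section Words

/-- The `n`-th letter of the periodic bi-infinite word `(a^{±r} b a^{±r} b⁻¹)^∞`. -/
def letter (r : ℕ) (e : Bool) (n : ℕ) : Fin 2 × Bool :=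
  if n % (2 * r + 2) = r then (1, true)
  else if n % (2 * r + 2) = 2 * r + 1 then (1, false) else (0, e)

/-- The subword of length `K` starting at position `m`. -/
def periodicWord (r : ℕ) (e : Bool) (m K : ℕ) : Word (Fin 2) :=
  (List.range K).map fun k => letter r e (m + k)

theorem length_periodicWord (r : ℕ) (e : Bool) (m K : ℕ) :
    (periodicWord r e m K).length = K := by
  simp [periodicWord]

theorem getElem_periodicWord (r : ℕ) (e : Bool) (m K k : ℕ)
    (h : k < (periodicWord r e m K).length) : (periodicWord r e m K)[k] = letter r e (m + k) := by
  simp [periodicWord]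

theorem letter_congr {r : ℕ} {e : Bool} {m n : ℕ} (h : m ≡ n [MOD 2 * r + 2]) :
    letter r e m = letter r e n := by
  have h' : m % (2 * r + 2) = n % (2 * r + 2) := h
  simp only [letter, h']

theorem periodicWord_congr {r : ℕ} {e : Bool} {m n : ℕ} (h : m ≡ n [MOD 2 * r + 2]) (K : ℕ) :
    periodicWord r e m K = periodicWord r e n K := by
  unfold periodicWord
  refine List.map_congr_left fun k _ => letter_congr (h.add_right k)

theorem periodicWord_add (r : ℕ) (e : Bool) (m K L : ℕ) :
    periodicWord r e m (K + L) = periodicWord r e m K ++ periodicWord r e (m + K) L := by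
  simp [periodicWord, List.range_add, Function.comp_def, add_assoc]

theorem periodicWord_eq_replicate (r : ℕ) (e : Bool) (m K : ℕ) (x : Fin 2 × Bool)
    (h : ∀ k < K, letter r e (m + k) = x) : periodicWord r e m K = List.replicate K x := by
  refine List.eq_replicate_iff.2 ⟨length_periodicWord r e m K, fun y hy => ?_⟩
  simp only [periodicWord, List.mem_map, List.mem_range] at hy
  obtain ⟨k, hk, rfl⟩ := hy
  exact h k hk

theorem letter_of_lt {r n : ℕ} (e : Bool) (hn : n < 2 * r + 2) :
    letter r e n = if n = r then (1, true) else if n = 2 * r + 1 then (1, false) else (0, e) := by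
  rw [letter, Nat.mod_eq_of_lt hn]

theorem relWord13_eq (r n : ℕ) : relWord13 r n = periodicWord r true 0 (n * (2 * r + 2)) := by
  have hblock : List.replicate r ((0 : Fin 2), true) ++ [((1 : Fin 2), true)] ++
      List.replicate r ((0 : Fin 2), true) ++ [((1 : Fin 2), false)] =
      periodicWord r true 0 (2 * r + 2) := by
    have h : 2 * r + 2 = r + 1 + r + 1 := by ring
    rw [h, periodicWord_add, periodicWord_add, periodicWord_add,
      periodicWord_eq_replicate r true 0 r (0, true),
      periodicWord_eq_replicate r true (0 + r) 1 (1, true),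
      periodicWord_eq_replicate r true (0 + (r + 1)) r (0, true),
      periodicWord_eq_replicate r true (0 + (r + 1 + r)) 1 (1, false)]
    · simp
    all_goals
      intro k hk
      rw [letter_of_lt _ (by omega)]
      split_ifs <;> first | rfl | omega
  unfold relWord13
  induction n with
  | zero => simp [periodicWord]
  | succ n ih =>
    have h : (n + 1) * (2 * r + 2) = 2 * r + 2 + n * (2 * r + 2) := by ring
    rw [List.replicate_succ, List.flatten_cons, ih, hblock, h,
      periodicWord_add r true 0 (2 * r + 2)]
    congr 1
    refine periodicWord_congr ?_ _
    simp [Nat.ModEq]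

theorem periodicWord_rotate {r : ℕ} {e : Bool} {m K : ℕ} (hK : 2 * r + 2 ∣ K) (n : ℕ) :
    (periodicWord r e m K).rotate n = periodicWord r e (m + n) K := by
  refine List.ext_getElem (by simp [length_periodicWord]) fun k h1 h2 => ?_
  rw [List.getElem_rotate, getElem_periodicWord, getElem_periodicWord, length_periodicWord]
  refine letter_congr ?_
  rw [add_assoc, add_comm n]
  exact Nat.ModEq.add_left m ((Nat.mod_modEq _ K).of_dvd hK)

theorem letter_inv {r a b : ℕ} (e : Bool) (h : a + b ≡ 3 * r + 1 [MOD 2 * r + 2]) :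
    letter r (!e) b = ((letter r e a).1, !(letter r e a).2) := by
  have hb := Nat.mod_lt b (show 0 < 2 * r + 2 by omega)
  have ha := Nat.mod_lt a (show 0 < 2 * r + 2 by omega)
  have h1 : a % (2 * r + 2) + b % (2 * r + 2) ≡ 3 * r + 1 [MOD 2 * r + 2] :=
    ((Nat.mod_modEq a _).add (Nat.mod_modEq b _)).trans h
  rw [Nat.ModEq] at h1
  have h2 : (3 * r + 1) % (2 * r + 2) = if r = 0 then 1 else r - 1 := by
    split_ifs with h0
    · subst h0; rfl
    · rw [Nat.mod_eq_sub_mod (by omega), Nat.mod_eq_of_lt (by omega)]; omega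
  rw [h2] at h1
  clear h2 h
  unfold letter
  generalize a % (2 * r + 2) = x at *
  generalize b % (2 * r + 2) = y at *
  have h3 : (x + y) % (2 * r + 2) = x + y ∨
      2 * r + 2 ≤ x + y ∧ (x + y) % (2 * r + 2) = x + y - (2 * r + 2) := by
    by_cases h4 : x + y < 2 * r + 2
    · exact Or.inl (Nat.mod_eq_of_lt h4)
    · refine Or.inr ⟨by omega, ?_⟩
      rw [Nat.mod_eq_sub_mod (by omega), Nat.mod_eq_of_lt (by omega)]
  have h5 := Nat.mod_lt (x + y) (show 0 < 2 * r + 2 by omega)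
  by_cases hr : r = 0
  · rw [if_pos hr] at h1
    rcases h3 with h3 | ⟨h4, h3⟩ <;> rw [h3] at h1 <;> split_ifs <;> first | rfl | omega
  · rw [if_neg hr] at h1
    rcases h3 with h3 | ⟨h4, h3⟩ <;> rw [h3] at h1 <;> split_ifs <;> first | rfl | omega

theorem wordInv_periodicWord {r : ℕ} (e : Bool) (m : ℕ) {K : ℕ} (hK : 2 * r + 2 ∣ K) :
    wordInv (periodicWord r e m K) = periodicWord r (!e) (3 * r + 2 + m * (2 * r + 1)) K := by
  refine List.ext_getElem (by simp [wordInv, length_periodicWord]) fun k h1 h2 => ?_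
  rw [length_periodicWord] at h2
  simp only [wordInv, List.getElem_reverse, List.getElem_map, getElem_periodicWord,
    List.length_map, length_periodicWord]
  refine (letter_inv e ?_).symm
  have : m + (K - 1 - k) + (3 * r + 2 + m * (2 * r + 1) + k) =
      m * (2 * r + 2) + K + (3 * r + 1) := by
    have : K - 1 - k + k + 1 = K := by omega
    linear_combination this
  obtain ⟨c, rfl⟩ := hK
  have h : m * (2 * r + 2) + (2 * r + 2) * c + (3 * r + 1) =
      3 * r + 1 + (2 * r + 2) * (m + c) := by ring
  rw [this, h, Nat.ModEq, Nat.add_mul_mod_self_left]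

theorem exists_letter_fst (r m : ℕ) (e : Bool) : ∃ k ≤ r, (letter r e (m + k)).1 = 1 := by
  have ht := Nat.mod_lt m (show 0 < 2 * r + 2 by omega)
  by_cases h : m % (2 * r + 2) ≤ r
  · refine ⟨r - m % (2 * r + 2), by omega, ?_⟩
    rw [letter_congr ((Nat.mod_modEq m _).symm.add_right _), letter_of_lt _ (by omega),
      if_pos (by omega)]
  · refine ⟨2 * r + 1 - m % (2 * r + 2), by omega, ?_⟩
    rw [letter_congr ((Nat.mod_modEq m _).symm.add_right _), letter_of_lt _ (by omega),
      if_neg (by omega), if_pos (by omega)]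

theorem letter_fst_iff {r n : ℕ} {e : Bool} : (letter r e n).1 = 1 ↔
    n % (2 * r + 2) = r ∨ n % (2 * r + 2) = 2 * r + 1 := by
  unfold letter
  split_ifs <;> simp_all

theorem letter_gap {r n i : ℕ} {e : Bool} (hn : (letter r e n).1 = 1) (h0 : 0 < i)
    (hi : i ≤ r + 1) : letter r e (n + i) = (0, e) ∧ i ≤ r ∨
      (letter r e (n + i)).1 = 1 ∧ i = r + 1 := by
  rcases letter_fst_iff.1 hn with h | h
  · rw [letter_congr ((Nat.mod_modEq n _).symm.add_right _), h, letter_of_lt _ (by omega)]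
    split_ifs <;> simp <;> omega
  · have : n + i ≡ i - 1 [MOD 2 * r + 2] := by
      have h1 : n + i ≡ (2 * r + 1) + i [MOD 2 * r + 2] := by
        have := (Nat.mod_modEq n (2 * r + 2)).symm.add_right i
        rwa [h] at this
      have h2 : 2 * r + 1 + i = (2 * r + 2) + (i - 1) := by omega
      rw [h2] at h1
      simpa [Nat.ModEq] using h1
    rw [letter_congr this, letter_of_lt _ (by omega)]
    split_ifs <;> simp <;> omega

theorem reduced_periodicWord {r : ℕ} (hr : 1 ≤ r) (e : Bool) (m K : ℕ) :
    Reduced (periodicWord r e m K) := by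
  change List.IsChain _ _
  rw [List.isChain_iff_getElem]
  intro k hk
  rw [getElem_periodicWord, getElem_periodicWord, ← add_assoc]
  by_cases h : (letter r e (m + k)).1 = 1
  · rcases letter_gap h one_pos (by omega) with ⟨h1, -⟩ | ⟨-, h1⟩
    · left; rw [h, h1]; simp
    · omega
  · by_cases h' : (letter r e (m + k + 1)).1 = 1
    · left; rw [h']; exact h
    · right
      have key : ∀ n, (letter r e n).1 ≠ 1 → (letter r e n).2 = e := by
        intro n hn
        unfold letter at *
        split_ifs at * <;> simp_all
      rw [key _ h, key _ h']

theorem cyclicallyReduced_periodicWord {r : ℕ} (hr : 1 ≤ r) (e : Bool) (m : ℕ) {K : ℕ}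
    (hK : 2 * r + 2 ∣ K) : CyclicallyReduced (periodicWord r e m K) := by
  have : periodicWord r e m K ++ periodicWord r e m K = periodicWord r e m (K + K) := by
    rw [periodicWord_add]
    congr 1
    refine periodicWord_congr ?_ _
    obtain ⟨c, rfl⟩ := hK
    simp [Nat.ModEq]
  unfold CyclicallyReduced
  rw [this]
  exact reduced_periodicWord hr e m _

theorem letter_determined {r s m m' : ℕ} {e e' : Bool} (hr : 1 ≤ r)
    (h : ∀ k < 2 * r + 2, letter r e (m + k) = letter s e' (m' + k)) :
    r = s ∧ e = e' ∧ m ≡ m' [MOD 2 * r + 2] := by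
  obtain ⟨k, hk, hk1⟩ := exists_letter_fst r m e
  have hk1' : (letter s e' (m' + k)).1 = 1 := by rw [← h k (by omega)]; exact hk1
  have hrs : r = s := by
    rcases lt_trichotomy r s with hlt | heq | hgt
    · rcases letter_gap hk1' (Nat.succ_pos r) (by omega) with ⟨h1, -⟩ | ⟨-, h1⟩
      · rcases letter_gap hk1 (Nat.succ_pos r) le_rfl with ⟨-, h2⟩ | ⟨h2, -⟩
        · omega
        · rw [add_assoc, h _ (by omega), ← add_assoc, h1] at h2
          simp at h2
      · omega
    · exact heq
    · rcases letter_gap hk1 (Nat.succ_pos s) (by omega) with ⟨h1, -⟩ | ⟨-, h1⟩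
      · rcases letter_gap hk1' (Nat.succ_pos s) le_rfl with ⟨-, h2⟩ | ⟨h2, -⟩
        · omega
        · rw [add_assoc, ← h _ (by omega), ← add_assoc, h1] at h2
          simp at h2
      · omega
  subst hrs
  refine ⟨rfl, ?_, ?_⟩
  · rcases letter_gap hk1 one_pos (by omega) with ⟨h1, -⟩ | ⟨-, h1⟩
    · rcases letter_gap hk1' one_pos (by omega) with ⟨h2, -⟩ | ⟨-, h2⟩
      · rw [add_assoc, h _ (by omega), ← add_assoc, h2] at h1
        injection h1 with _ h3
        exact h3.symm
      · omega
    · omega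
  · have h1 := h k (by omega)
    have : m + k ≡ m' + k [MOD 2 * r + 2] := by
      rw [Nat.ModEq]
      rw [letter_fst_iff] at hk1 hk1'
      unfold letter at h1
      rcases hk1 with h2 | h2 <;> rcases hk1' with h3 | h3
      · rw [h2, h3]
      · rw [if_pos h2, if_neg (by omega), if_pos h3] at h1
        exact absurd h1 (by decide)
      · rw [if_pos h3, if_neg (by omega), if_pos h2] at h1
        exact absurd h1 (by decide)
      · rw [h2, h3]
    exact Nat.ModEq.add_right_cancel' k this

/-- The relators of the statement, for exponents `N`. -/
def baseRels (N : ℕ → ℕ) : Set (Word (Fin 2)) :=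
  {w : Word (Fin 2) | ∃ r : ℕ, 1 ≤ r ∧ w = relWord13 r (N r)}

theorem exists_periodicWord_of_mem {N : ℕ → ℕ} {w : Word (Fin 2)}
    (hw : w ∈ symmClosure (baseRels N)) :
    ∃ r e m, 1 ≤ r ∧ w = periodicWord r e m (N r * (2 * r + 2)) := by
  obtain ⟨_, ⟨r, hr, rfl⟩, n, h⟩ := hw
  have hd : 2 * r + 2 ∣ N r * (2 * r + 2) := Dvd.intro_left _ rfl
  rw [relWord13_eq, periodicWord_rotate hd, wordInv_periodicWord _ _ hd] at h
  rcases h with rfl | rfl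
  · exact ⟨r, _, _, hr, rfl⟩
  · exact ⟨r, _, _, hr, rfl⟩

theorem piece_bound {N : ℕ → ℕ} (hN : ∀ r, 1 ≤ r → 6 ≤ N r) {w p : Word (Fin 2)}
    (hw : w ∈ symmClosure (baseRels N)) (hp : p <+: w)
    (hpiece : IsPiece (symmClosure (baseRels N)) p) : 6 * p.length < w.length := by
  obtain ⟨r, e, m, hr, rfl⟩ := exists_periodicWord_of_mem hw
  have hlt : p.length < 2 * r + 2 := by
    by_contra hge
    have key : ∀ w' ∈ symmClosure (baseRels N), p <+: w' →
        periodicWord r e m (N r * (2 * r + 2)) = w' := by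
      intro w' hw' hp'
      obtain ⟨s, e', m', hs, rfl⟩ := exists_periodicWord_of_mem hw'
      obtain ⟨rfl, rfl, h⟩ := letter_determined
        (s := s) (m := m) (m' := m') (e := e) (e' := e') hr (by
        intro k hk
        have h1 := hp.getElem (i := k) (by omega)
        have h2 := hp'.getElem (i := k) (by omega)
        rw [getElem_periodicWord] at h1 h2
        rw [← h1, ← h2])
      exact periodicWord_congr h _
    obtain ⟨w₁, h₁, w₂, h₂, hne, hp₁, hp₂⟩ := hpiece
    exact hne ((key w₁ h₁ hp₁).symm.trans (key w₂ h₂ hp₂))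
  rw [length_periodicWord]
  have := Nat.mul_le_mul_right (2 * r + 2) (hN r hr)
  omega

theorem cyclicallyReduced_of_mem {N : ℕ → ℕ} {w : Word (Fin 2)}
    (hw : w ∈ symmClosure (baseRels N)) : CyclicallyReduced w := by
  obtain ⟨r, e, m, hr, rfl⟩ := exists_periodicWord_of_mem hw
  exact cyclicallyReduced_periodicWord hr _ _ (Dvd.intro_left _ rfl)

theorem subset_symmClosure {S : Type} (R : Set (Word S)) : R ⊆ symmClosure R :=
  fun r hr => ⟨r, hr, 0, Or.inl (by simp)⟩

theorem wordInv_wordInv {S : Type} (w : Word S) : wordInv (wordInv w) = w := by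
  simp [wordInv, Function.comp_def]

theorem wordInv_mem_symmClosure {S : Type} {R : Set (Word S)} {w : Word S}
    (hw : w ∈ symmClosure R) : wordInv w ∈ symmClosure R := by
  obtain ⟨r, hr, n, rfl | rfl⟩ := hw
  · exact ⟨r, hr, n, Or.inr rfl⟩
  · exact ⟨r, hr, n, Or.inl (wordInv_wordInv _)⟩

theorem rotate_mem_symmClosure {S : Type} {R : Set (Word S)} {w : Word S}
    (hw : w ∈ symmClosure R) (n : ℕ) : w.rotate n ∈ symmClosure R := by
  obtain ⟨r, hr, k, rfl | rfl⟩ := hw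
  · exact ⟨r, hr, k + n, Or.inl (by rw [List.rotate_rotate])⟩
  · refine ⟨r, hr, k + (r.length - n % r.length), Or.inr ?_⟩
    rw [wordInv, List.rotate_reverse, ← List.map_rotate, ← List.rotate_rotate, wordInv]
    simp

theorem cprimeCollection_baseRels {N : ℕ → ℕ} (hN : ∀ r, 1 ≤ r → 6 ≤ N r) :
    CprimeCollection 6 (baseRels N) :=
  ⟨fun _ hr => cyclicallyReduced_of_mem (subset_symmClosure _ hr),
    fun _ hr _ hp hpiece => piece_bound hN hr hp hpiece⟩

/-- The small cancellation presentation with relators `(a^r b a^r b⁻¹)^{N r}`. -/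
def presentation (N : ℕ → ℕ) (hN : ∀ r, 1 ≤ r → 6 ≤ N r) : C6Presentation (Fin 2) where
  rels := symmClosure (baseRels N)
  cyclically_reduced _ hr := cyclicallyReduced_of_mem hr
  inv_mem _ hr := wordInv_mem_symmClosure hr
  rotate_mem _ hr n := rotate_mem_symmClosure hr n
  small_cancellation _ hr _ hp hpiece := piece_bound hN hr hp hpiece

theorem wordVal_append {S : Type} (u v : Word S) : wordVal (u ++ v) = wordVal u * wordVal v := by
  simp [wordVal]

theorem wordVal_wordInv {S : Type} (w : Word S) : wordVal (wordInv w) = (wordVal w)⁻¹ := by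
  induction w with
  | nil => simp [wordVal, wordInv]
  | cons a w ih =>
    have h1 : wordInv (a :: w) = wordInv w ++ wordInv [a] := by simp [wordInv]
    have h2 : wordVal (wordInv [a]) = (wordVal [a])⁻¹ := by
      obtain ⟨x, b⟩ := a
      cases b <;> simp [wordVal, wordInv]
    rw [h1, wordVal_append, ih, h2, ← mul_inv_rev, ← wordVal_append, List.singleton_append]

theorem map_wordVal_eq_one_of_mem {S H : Type} [Group H] (f : FreeGroup S →* H) {R : Set (Word S)}
    (hf : ∀ r ∈ R, f (wordVal r) = 1) {w : Word S} (hw : w ∈ symmClosure R) :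
    f (wordVal w) = 1 := by
  have key : ∀ r ∈ R, ∀ n, f (wordVal (r.rotate n)) = 1 := by
    intro r hr n
    rw [List.rotate_eq_drop_append_take_mod, wordVal_append, map_mul]
    have h := hf r hr
    rw [← List.take_append_drop (n % r.length) r, wordVal_append, map_mul] at h
    exact mul_eq_one_comm.1 h
  obtain ⟨r, hr, n, rfl | rfl⟩ := hw
  · exact key r hr n
  · rw [wordVal_wordInv, map_inv, key r hr n, inv_one]

theorem wordVal_relWord13 (r n : ℕ) : wordVal (relWord13 r n) =
    (FreeGroup.of (0 : Fin 2) ^ r * FreeGroup.of 1 * FreeGroup.of 0 ^ r *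
      (FreeGroup.of 1)⁻¹) ^ n := by
  unfold relWord13
  induction n with
  | zero => simp [wordVal]
  | succ n ih =>
    rw [List.replicate_succ, List.flatten_cons, wordVal_append, ih, pow_succ']
    congr 1
    simp [wordVal, mul_assoc]

end Words

section Model

variable {N : ℕ → ℕ} (hN : ∀ r, 1 ≤ r → 6 ≤ N r)

/-- The Coxeter matrix on `ℤ × {±1}` with `m((i,ε),(j,ε)) = N |i - j|` for `i ≠ j`. -/
def lineMatrix : CoxeterMatrix (ℤ × ℤˣ) where
  M i j := if i = j then 1 else if i.2 = j.2 then N (i.1 - j.1).natAbs else 0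
  isSymm := by
    refine Matrix.IsSymm.ext fun i j => ?_
    have h : (j.1 - i.1).natAbs = (i.1 - j.1).natAbs := by omega
    simp only [eq_comm (a := j), eq_comm (a := j.2), h]
  diagonal i := by simp
  off_diagonal i j hij := by
    rw [if_neg hij]
    split_ifs with h
    · have h1 : i.1 ≠ j.1 := fun h1 => hij (Prod.ext h1 h)
      have := hN (i.1 - j.1).natAbs (by omega)
      omega
    · simp

theorem lineMatrix_apply (i j : ℤ × ℤˣ) : lineMatrix hN i j =
    if i = j then 1 else if i.2 = j.2 then N (i.1 - j.1).natAbs else 0 := rfl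

theorem natAbs_pos_of_ne {i j : ℤ × ℤˣ} (hij : i ≠ j) (h : i.2 = j.2) :
    1 ≤ (i.1 - j.1).natAbs := by
  have h1 : i.1 ≠ j.1 := fun h1 => hij (Prod.ext h1 h)
  omega

theorem evenLarge_lineMatrix (hev : ∀ r, 1 ≤ r → Even (N r)) : EvenLarge (lineMatrix hN) := by
  intro i j hij
  rw [lineMatrix_apply, if_neg hij]
  split_ifs with h
  · have := natAbs_pos_of_ne hij h
    exact ⟨hev _ this, Or.inr (hN _ this)⟩
  · simp

/-- The Coxeter system of `lineMatrix`. -/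
abbrev lineSystem : CoxeterSystem (lineMatrix hN) (lineMatrix hN).Group :=
  (lineMatrix hN).toCoxeterSystem

/-- The vertices of the graph of spaces: a line for each element of the Coxeter group. -/
abbrev Vertex : Type := (lineMatrix hN).Group × ℤ

/-- The sign character of the Coxeter group. -/
noncomputable def sgn : (lineMatrix hN).Group →* ℤˣ :=
  (lineSystem hN).lift ⟨fun _ => -1, fun i j => by simp⟩

theorem sgn_simple (i : ℤ × ℤˣ) : sgn hN ((lineSystem hN).simple i) = -1 :=
  (lineSystem hN).lift_apply_simple _ i

/-- Vertical translation, in the direction given by the sign. -/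
noncomputable def shiftPerm : Equiv.Perm (Vertex hN) where
  toFun p := (p.1, p.2 + sgn hN p.1)
  invFun p := (p.1, p.2 - sgn hN p.1)
  left_inv p := by simp
  right_inv p := by simp

/-- Crossing to a neighbouring line. -/
noncomputable def crossPerm : Equiv.Perm (Vertex hN) where
  toFun p := (p.1 * (lineSystem hN).simple (p.2, sgn hN p.1), p.2)
  invFun p := (p.1 * (lineSystem hN).simple (p.2, -sgn hN p.1), p.2)
  left_inv p := by simp [sgn_simple, -CoxeterMatrix.toCoxeterSystem_simple]
  right_inv p := by simp [sgn_simple, -CoxeterMatrix.toCoxeterSystem_simple]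

theorem shiftPerm_pow (k : ℕ) (p : Vertex hN) :
    (shiftPerm hN ^ k) p = (p.1, p.2 + k * sgn hN p.1) := by
  induction k with
  | zero => simp
  | succ k ih =>
    rw [pow_succ', Equiv.Perm.mul_apply, ih]
    simp only [shiftPerm, Equiv.coe_fn_mk, Prod.mk.injEq, true_and]
    push_cast; ring

/-- The images of the two generators. -/
noncomputable def genPerm (x : Fin 2) : (Equiv.Perm (Vertex hN))ᵐᵒᵖ :=
  if x = 0 then MulOpposite.op (shiftPerm hN) else MulOpposite.op (crossPerm hN)

theorem relator_perm_apply (r : ℕ) (w : (lineMatrix hN).Group) (n : ℤ) :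
    ((crossPerm hN)⁻¹ * (shiftPerm hN ^ r * (crossPerm hN * shiftPerm hN ^ r))) (w, n) =
      (w * ((lineSystem hN).simple (n + r * sgn hN w, sgn hN w) *
        (lineSystem hN).simple (n, sgn hN w)), n) := by
  simp only [Equiv.Perm.mul_apply, shiftPerm_pow]
  simp [crossPerm, sgn_simple, Equiv.Perm.inv_def, -CoxeterMatrix.toCoxeterSystem_simple, mul_assoc]

theorem relator_perm_pow {r : ℕ} (hr : 1 ≤ r) :
    ((crossPerm hN)⁻¹ * (shiftPerm hN ^ r * (crossPerm hN * shiftPerm hN ^ r))) ^ (N r) = 1 := by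
  ext1 ⟨w, n⟩
  have key : ∀ k : ℕ,
      (((crossPerm hN)⁻¹ * (shiftPerm hN ^ r * (crossPerm hN * shiftPerm hN ^ r))) ^ k) (w, n) =
      (w * ((lineSystem hN).simple (n + r * sgn hN w, sgn hN w) *
        (lineSystem hN).simple (n, sgn hN w)) ^ k, n) := by
    intro k
    induction k with
    | zero => simp
    | succ k ih =>
      rw [pow_succ', Equiv.Perm.mul_apply, ih, relator_perm_apply]
      have : sgn hN (w * ((lineSystem hN).simple (n + r * sgn hN w, sgn hN w) *
          (lineSystem hN).simple (n, sgn hN w)) ^ k) = sgn hN w := by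
        simp [sgn_simple, -CoxeterMatrix.toCoxeterSystem_simple]
      rw [this, pow_succ, mul_assoc w]
  rw [key]
  have hne : ((n + r * sgn hN w, sgn hN w) : ℤ × ℤˣ) ≠ (n, sgn hN w) := by
    intro h
    have := congrArg Prod.fst h
    rcases Int.units_eq_one_or (sgn hN w) with h1 | h1 <;> rw [h1] at this <;> simp at this <;>
      omega
  have hM : lineMatrix hN (n + r * sgn hN w, sgn hN w) (n, sgn hN w) = N r := by
    rw [lineMatrix_apply, if_neg hne, if_pos rfl]
    congr 1
    rcases Int.units_eq_one_or (sgn hN w) with h1 | h1 <;> rw [h1] <;> simp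
  rw [← hM, (lineSystem hN).simple_mul_simple_pow]
  simp

theorem lift_eq_one {H : Type} [Group H] (f : Fin 2 → H)
    (hf : ∀ r, 1 ≤ r → (f 0 ^ r * f 1 * f 0 ^ r * (f 1)⁻¹) ^ (N r) = 1) :
    ∀ x ∈ wordVal '' (presentation N hN).rels, FreeGroup.lift f x = 1 := by
  rintro _ ⟨w, hw, rfl⟩
  refine map_wordVal_eq_one_of_mem _ ?_ hw
  rintro _ ⟨r, hr, rfl⟩
  rw [wordVal_relWord13]
  simpa using hf r hr

/-- The homomorphism from the presented group given by images of the generators. -/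
noncomputable def homOf {H : Type} [Group H] (f : Fin 2 → H)
    (hf : ∀ r, 1 ≤ r → (f 0 ^ r * f 1 * f 0 ^ r * (f 1)⁻¹) ^ (N r) = 1) :
    (presentation N hN).Grp →* H :=
  PresentedGroup.toGroup (lift_eq_one hN f hf)

theorem homOf_of {H : Type} [Group H] (f : Fin 2 → H)
    (hf : ∀ r, 1 ≤ r → (f 0 ^ r * f 1 * f 0 ^ r * (f 1)⁻¹) ^ (N r) = 1) (x : Fin 2) :
    homOf hN f hf (PresentedGroup.of x) = f x :=
  PresentedGroup.toGroup.of _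

/-- The first generator. -/
abbrev genA : (presentation N hN).Grp := PresentedGroup.of 0

/-- The second generator. -/
abbrev genB : (presentation N hN).Grp := PresentedGroup.of 1

theorem relator_pow {r : ℕ} (hr : 1 ≤ r) :
    (genA hN ^ r * genB hN * genA hN ^ r * (genB hN)⁻¹) ^ (N r) = 1 := by
  have h : PresentedGroup.mk (wordVal '' (presentation N hN).rels)
      (wordVal (relWord13 r (N r))) = 1 :=
    PresentedGroup.one_of_mem ⟨_, subset_symmClosure _ ⟨r, hr, rfl⟩, rfl⟩
  rw [wordVal_relWord13] at h
  simp only [map_pow, map_mul, map_inv] at h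
  exact h

/-- The right action of the presented group on the vertices, as a homomorphism. -/
noncomputable def actHom : (presentation N hN).Grp →* (Equiv.Perm (Vertex hN))ᵐᵒᵖ :=
  homOf hN (genPerm hN) (by
    intro r hr
    have h := relator_perm_pow hN hr
    simp only [genPerm, if_pos, Fin.isValue, one_ne_zero, if_false]
    rw [← MulOpposite.op_pow, ← MulOpposite.op_mul, ← MulOpposite.op_mul, ← MulOpposite.op_inv,
      ← MulOpposite.op_mul, ← MulOpposite.op_pow, h, MulOpposite.op_one])

/-- The right action of the presented group on the vertices. -/
noncomputable def act (p : Vertex hN) (g : (presentation N hN).Grp) : Vertex hN :=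
  (actHom hN g).unop p

theorem act_mul (p : Vertex hN) (g h : (presentation N hN).Grp) :
    act hN p (g * h) = act hN (act hN p g) h := by
  simp [act]

theorem act_one (p : Vertex hN) : act hN p 1 = p := by
  simp [act]

theorem act_genA (p : Vertex hN) : act hN p (genA hN) = (p.1, p.2 + sgn hN p.1) := by
  simp [act, actHom, genA, homOf_of, genPerm, shiftPerm]

theorem act_genB (p : Vertex hN) :
    act hN p (genB hN) = (p.1 * (lineSystem hN).simple (p.2, sgn hN p.1), p.2) := by
  simp [act, actHom, genB, homOf_of, genPerm, crossPerm]

theorem act_inv_eq {p q : Vertex hN} {g : (presentation N hN).Grp} (h : act hN q g = p) :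
    act hN p g⁻¹ = q := by
  rw [← h, ← act_mul, mul_inv_cancel, act_one]

theorem act_genA_inv (p : Vertex hN) : act hN p (genA hN)⁻¹ = (p.1, p.2 - sgn hN p.1) :=
  act_inv_eq hN (by simp [act_genA])

theorem act_genB_inv (p : Vertex hN) :
    act hN p (genB hN)⁻¹ = (p.1 * (lineSystem hN).simple (p.2, -sgn hN p.1), p.2) :=
  act_inv_eq hN (by
    rw [act_genB]; simp [sgn_simple, -CoxeterMatrix.toCoxeterSystem_simple])

theorem act_genA_zpow (p : Vertex hN) (k : ℤ) :
    act hN p (genA hN ^ k) = (p.1, p.2 + k * sgn hN p.1) := by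
  induction k with
  | zero => simp [act_one]
  | succ k ih =>
    rw [zpow_add_one, act_mul, ih, act_genA]
    simp only [Prod.mk.injEq, true_and]
    ring
  | pred k ih =>
    rw [zpow_sub_one, act_mul, ih, act_genA_inv]
    simp only [Prod.mk.injEq, true_and]
    ring

/-- The automorphism inverting both generators. -/
noncomputable def flip : (presentation N hN).Grp →* (presentation N hN).Grp :=
  homOf hN (fun x => (PresentedGroup.of x)⁻¹) (by
    intro r hr
    have h := relator_pow hN hr
    have e : ((genA hN)⁻¹ ^ r * (genB hN)⁻¹ * (genA hN)⁻¹ ^ r * ((genB hN)⁻¹)⁻¹) =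
        (genB hN)⁻¹ * (genA hN ^ r * genB hN * genA hN ^ r * (genB hN)⁻¹)⁻¹ * ((genB hN)⁻¹)⁻¹ := by
      group
    rw [e, conj_pow, inv_pow, h]
    simp)

theorem flip_genA_zpow (k : ℤ) : flip hN (genA hN ^ k) = genA hN ^ (-k) := by
  rw [map_zpow, flip, genA, homOf_of, inv_zpow, zpow_neg]

theorem flip_genB_zpow (k : ℤ) : flip hN (genB hN ^ k) = genB hN ^ (-k) := by
  rw [map_zpow, flip, genB, homOf_of, inv_zpow, zpow_neg]

theorem flip_flip (x : (presentation N hN).Grp) : flip hN (flip hN x) = x := by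
  have : (flip hN).comp (flip hN) = MonoidHom.id _ := by
    refine PresentedGroup.ext fun i => ?_
    simp [flip, homOf_of]
  exact DFunLike.congr_fun this x

/-- The involution of the group corresponding to a simple reflection. -/
noncomputable def foldFun (i : ℤ × ℤˣ) (x : (presentation N hN).Grp) : (presentation N hN).Grp :=
  genA hN ^ i.1 * genB hN ^ (i.2 : ℤ) * genA hN ^ i.1 * flip hN x

theorem foldFun_foldFun (i j : ℤ × ℤˣ) (x : (presentation N hN).Grp) :
    foldFun hN i (foldFun hN j x) = genA hN ^ i.1 * genB hN ^ (i.2 : ℤ) * genA hN ^ i.1 *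
      (genA hN ^ (-j.1) * genB hN ^ (-j.2 : ℤ) * genA hN ^ (-j.1)) * x := by
  simp only [foldFun, map_mul, flip_genA_zpow, flip_genB_zpow, flip_flip, mul_assoc]

theorem foldFun_involutive (i : ℤ × ℤˣ) : Function.Involutive (foldFun hN i) := by
  intro x
  rw [foldFun_foldFun]
  group

/-- `foldFun` as a permutation. -/
noncomputable def foldPerm (i : ℤ × ℤˣ) : Equiv.Perm (presentation N hN).Grp :=
  (foldFun_involutive hN i).toPerm

theorem relator_zpow {k : ℤ} (hk : k ≠ 0) (ε : ℤˣ) :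
    (genA hN ^ k * genB hN ^ (ε : ℤ) * genA hN ^ k * genB hN ^ (-ε : ℤ)) ^ (N k.natAbs) = 1 := by
  have h := relator_pow hN (r := k.natAbs) (by omega)
  obtain ⟨r, rfl | rfl⟩ := Int.eq_nat_or_neg k
  · rw [Int.natAbs_natCast] at *
    rcases Int.units_eq_one_or ε with rfl | rfl
    · simpa using h
    · have e : genA hN ^ (r : ℤ) * genB hN ^ ((-1 : ℤˣ) : ℤ) * genA hN ^ (r : ℤ) *
          genB hN ^ (-((-1 : ℤˣ) : ℤ)) = (genA hN ^ r * (genB hN)⁻¹) *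
          (genA hN ^ r * genB hN * genA hN ^ r * (genB hN)⁻¹) *
          (genA hN ^ r * (genB hN)⁻¹)⁻¹ := by
        simp [mul_assoc]
      rw [e, conj_pow, h]
      simp
  · rw [Int.natAbs_neg, Int.natAbs_natCast] at *
    rcases Int.units_eq_one_or ε with rfl | rfl
    · have e : genA hN ^ (-r : ℤ) * genB hN ^ ((1 : ℤˣ) : ℤ) * genA hN ^ (-r : ℤ) *
          genB hN ^ (-((1 : ℤˣ) : ℤ)) = (genA hN ^ (-r : ℤ)) *
          (genA hN ^ r * genB hN * genA hN ^ r * (genB hN)⁻¹)⁻¹ *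
          (genA hN ^ (-r : ℤ))⁻¹ := by
        simp [mul_assoc]
      rw [e, conj_pow, inv_pow, h]
      simp
    · have e : genA hN ^ (-r : ℤ) * genB hN ^ ((-1 : ℤˣ) : ℤ) * genA hN ^ (-r : ℤ) *
          genB hN ^ (-((-1 : ℤˣ) : ℤ)) = (genB hN)⁻¹ *
          (genA hN ^ r * genB hN * genA hN ^ r * (genB hN)⁻¹)⁻¹ * ((genB hN)⁻¹)⁻¹ := by
        simp [mul_assoc]
      rw [e, conj_pow, inv_pow, h]
      simp

theorem foldPerm_isLiftable : (lineMatrix hN).IsLiftable (foldPerm hN) := by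
  intro i j
  change (foldPerm hN i * foldPerm hN j) ^ (lineMatrix hN i j) = 1
  rw [lineMatrix_apply]
  split_ifs with h h'
  · subst h
    ext x
    rw [pow_one]
    exact foldFun_involutive hN i x
  · have hk := natAbs_pos_of_ne h h'
    obtain ⟨i, ε⟩ := i
    obtain ⟨j, ε'⟩ := j
    simp only at h' hk ⊢
    subst h'
    have e : genA hN ^ i * genB hN ^ (ε : ℤ) * genA hN ^ i *
        (genA hN ^ (-j) * genB hN ^ (-ε : ℤ) * genA hN ^ (-j)) = genA hN ^ j *
        (genA hN ^ (i - j) * genB hN ^ (ε : ℤ) * genA hN ^ (i - j) * genB hN ^ (-ε : ℤ)) *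
        (genA hN ^ j)⁻¹ := by
      group
    have key : ∀ (n : ℕ) x, ((foldPerm hN (i, ε) * foldPerm hN (j, ε)) ^ n) x =
        (genA hN ^ i * genB hN ^ (ε : ℤ) * genA hN ^ i *
        (genA hN ^ (-j) * genB hN ^ (-ε : ℤ) * genA hN ^ (-j))) ^ n * x := by
      intro n x
      induction n with
      | zero => simp
      | succ n ih =>
        rw [pow_succ', Equiv.Perm.mul_apply, ih, Equiv.Perm.mul_apply, pow_succ', mul_assoc _ _ x]
        exact foldFun_foldFun hN _ _ _
    ext x
    rw [key, e, conj_pow, relator_zpow hN (by omega)]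
    simp
  · simp

/-- The action of the Coxeter group on the presented group. -/
noncomputable def foldHom : (lineMatrix hN).Group →* Equiv.Perm (presentation N hN).Grp :=
  (lineSystem hN).lift ⟨foldPerm hN, foldPerm_isLiftable hN⟩

theorem foldHom_simple (i : ℤ × ℤˣ) (x : (presentation N hN).Grp) :
    foldHom hN ((lineSystem hN).simple i) x = foldFun hN i x := by
  rw [foldHom, (lineSystem hN).lift_apply_simple]
  rfl

theorem foldHom_mul_zpow (y : (presentation N hN).Grp)
    (hy : ∀ k : ℤ, flip hN (y ^ k) = y ^ (-k)) (w : (lineMatrix hN).Group) :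
    ∀ (x : (presentation N hN).Grp) (ε : ℤˣ),
      foldHom hN w (x * y ^ ((ε * sgn hN w : ℤˣ) : ℤ)) = foldHom hN w x * y ^ (ε : ℤ) := by
  induction w using (lineSystem hN).simple_induction_left with
  | one => simp
  | mul_simple_left w i ih =>
    intro x ε
    have h := ih x (-ε)
    rw [map_mul (sgn hN), map_mul (foldHom hN), Equiv.Perm.mul_apply, Equiv.Perm.mul_apply,
      sgn_simple, neg_one_mul,
      mul_neg, ← neg_mul, h, foldHom_simple, foldHom_simple, foldFun, foldFun, map_mul, hy]
    simp [mul_assoc]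

/-- The inverse of the orbit map `g ↦ act (1, 0) g`. -/
noncomputable def orbitInv (p : Vertex hN) : (presentation N hN).Grp :=
  foldHom hN p.1 (genA hN ^ p.2)

theorem orbitInv_act_genA (p : Vertex hN) :
    orbitInv hN (act hN p (genA hN)) = orbitInv hN p * genA hN := by
  rw [act_genA, orbitInv, orbitInv, zpow_add]
  simpa using foldHom_mul_zpow hN (genA hN) (flip_genA_zpow hN) p.1 (genA hN ^ p.2) 1

theorem orbitInv_act_genB (p : Vertex hN) :
    orbitInv hN (act hN p (genB hN)) = orbitInv hN p * genB hN := by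
  have h := foldHom_mul_zpow hN (genB hN) (flip_genB_zpow hN) p.1 (genA hN ^ p.2) 1
  rw [act_genB, orbitInv, orbitInv]
  simp only [map_mul, Equiv.Perm.mul_apply, foldHom_simple, foldFun, flip_genA_zpow]
  simpa [mul_assoc] using h

theorem orbitInv_act (p : Vertex hN) (g : (presentation N hN).Grp) :
    orbitInv hN (act hN p g) = orbitInv hN p * g := by
  have hg : g ∈ Subgroup.closure (Set.range
      (PresentedGroup.of (rels := wordVal '' (presentation N hN).rels))) := by
    rw [PresentedGroup.closure_range_of]; trivial
  induction hg using Subgroup.closure_induction generalizing p with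
  | mem x hx =>
    obtain ⟨i, rfl⟩ := hx
    fin_cases i
    · exact orbitInv_act_genA hN p
    · exact orbitInv_act_genB hN p
  | one => simp [act_one]
  | mul x y _ _ hx hy => rw [act_mul, hy, hx, mul_assoc]
  | inv x _ hx =>
    have h := hx (act hN p x⁻¹)
    rw [← act_mul, inv_mul_cancel, act_one] at h
    rw [h, mul_inv_cancel_right]

/-- The orbit map of the base vertex. -/
noncomputable def orbit (g : (presentation N hN).Grp) : Vertex hN := act hN (1, 0) g

theorem orbitInv_orbit (g : (presentation N hN).Grp) : orbitInv hN (orbit hN g) = g := by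
  rw [orbit, orbitInv_act]
  simp [orbitInv]

theorem orbit_injective : Function.Injective (orbit hN) :=
  Function.LeftInverse.injective (orbitInv_orbit hN)

theorem orbit_mul (g h : (presentation N hN).Grp) :
    orbit hN (g * h) = act hN (orbit hN g) h :=
  act_mul hN _ _ _

theorem orbit_zpow (n : ℤ) : orbit hN (genA hN ^ n) = (1, n) := by
  rw [orbit, act_genA_zpow]
  simp

theorem step_iff (p q : Vertex hN) : Step (lineSystem hN) Prod.fst p q ↔
    ∃ x ∈ ({genA hN, (genA hN)⁻¹, genB hN, (genB hN)⁻¹} : Set (presentation N hN).Grp),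
      q = act hN p x := by
  obtain ⟨w, n⟩ := p
  obtain ⟨w', n'⟩ := q
  simp only [Set.mem_insert_iff, Set.mem_singleton_iff, exists_eq_or_imp, exists_eq_left,
    act_genA, act_genA_inv, act_genB, act_genB_inv, Step, Prod.mk.injEq]
  constructor
  · rintro (⟨rfl, h⟩ | ⟨⟨j, ε⟩, rfl, rfl, rfl⟩)
    · rcases Int.units_eq_one_or (sgn hN w') with h1 | h1 <;> rw [h1] <;> simp <;> omega
    · by_cases h : ε = sgn hN w
      · exact Or.inr (Or.inr (Or.inl (by simp [h])))
      · have : ε = -sgn hN w := by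
          rcases Int.units_eq_one_or (sgn hN w) with h1 | h1 <;>
            rcases Int.units_eq_one_or ε with h2 | h2 <;> simp_all
        exact Or.inr (Or.inr (Or.inr (by simp [this])))
  · rintro (⟨rfl, h⟩ | ⟨rfl, h⟩ | ⟨rfl, rfl⟩ | ⟨rfl, rfl⟩)
    · left
      rcases Int.units_eq_one_or (sgn hN w') with h1 | h1 <;> rw [h1] at h <;> simp at h ⊢ <;> omega
    · left
      rcases Int.units_eq_one_or (sgn hN w') with h1 | h1 <;> rw [h1] at h <;> simp at h ⊢ <;> omega
    · exact Or.inr ⟨_, rfl, rfl, rfl⟩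
    · exact Or.inr ⟨_, rfl, rfl, rfl⟩

theorem mem_gens_iff (x : (presentation N hN).Grp) :
    x ∈ (presentation N hN).gens ↔ x = genA hN ∨ x = genB hN := by
  simp [C6Presentation.gens, Fin.exists_fin_two, eq_comm]

theorem conn_iff {L : ℕ} {p q : Vertex hN} : Conn (lineSystem hN) Prod.fst L p q ↔
    ∃ l : List (presentation N hN).Grp, l.length = L ∧
      (∀ x ∈ l, x ∈ (presentation N hN).gens ∨ x⁻¹ ∈ (presentation N hN).gens) ∧
      q = act hN p l.prod := by
  constructor
  · intro h
    induction h with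
    | refl p => exact ⟨[], rfl, by simp, by simp [act_one]⟩
    | cons hs _ ih =>
      obtain ⟨l, rfl, hl, rfl⟩ := ih
      obtain ⟨x, hx, rfl⟩ := (step_iff hN _ _).1 hs
      refine ⟨x :: l, rfl, ?_, by rw [List.prod_cons, act_mul]⟩
      intro y hy
      rcases List.mem_cons.1 hy with rfl | hy
      · simp only [mem_gens_iff]
        rcases hx with rfl | rfl | rfl | rfl <;> simp
      · exact hl y hy
  · rintro ⟨l, rfl, hl, rfl⟩
    induction l generalizing p with
    | nil => simpa [act_one] using Conn.refl p
    | cons x l ih =>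
      rw [List.prod_cons, act_mul]
      refine Conn.cons ((step_iff hN _ _).2 ⟨x, ?_, rfl⟩) (ih fun y hy => hl y (by simp [hy]))
      have := hl x (by simp)
      simp only [mem_gens_iff, inv_eq_iff_eq_inv] at this
      simp only [Set.mem_insert_iff, Set.mem_singleton_iff]
      tauto

theorem conn_orbit_iff {L : ℕ} {g h : (presentation N hN).Grp} :
    Conn (lineSystem hN) Prod.fst L (orbit hN g) (orbit hN h) ↔
    ∃ l : List (presentation N hN).Grp, l.length = L ∧
      (∀ x ∈ l, x ∈ (presentation N hN).gens ∨ x⁻¹ ∈ (presentation N hN).gens) ∧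
      l.prod = g⁻¹ * h := by
  rw [conn_iff]
  simp only [← orbit_mul, (orbit_injective hN).eq_iff]
  refine exists_congr fun l => and_congr Iff.rfl (and_congr Iff.rfl ?_)
  rw [eq_inv_mul_iff_mul_eq, eq_comm]

end Model

section Metric

variable {N : ℕ → ℕ} {hN : ∀ r, 1 ≤ r → 6 ≤ N r}

theorem close_natAbs_le {K g : ℕ} (hg : ∀ r, 1 ≤ r → N r ≤ K → r ≤ g) {i k : ℤ × ℤˣ}
    (h : Close (lineMatrix hN) K i k) : (i.1 - k.1).natAbs ≤ g := by
  rcases h with rfl | ⟨h0, hK⟩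
  · simp
  · by_cases hik : i = k
    · simp [hik]
    · rw [lineMatrix_apply, if_neg hik] at h0 hK
      split_ifs at h0 hK with h
      · exact hg _ (natAbs_pos_of_ne hik h) hK
      · exact absurd rfl h0

/-- Two closest points on the base line of one vertex are close to each other. -/
theorem natAbs_sub_le_of_conn (hev : ∀ r, 1 ≤ r → Even (N r)) {D K g : ℕ}
    {w : (lineMatrix hN).Group} {n m₁ m₂ : ℤ} (hg : ∀ r, 1 ≤ r → N r ≤ K → r ≤ g)
    (hD : ∀ L m, Conn (lineSystem hN) Prod.fst L (w, n) (1, m) → D ≤ L) (hDK : D ≤ K)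
    (h₁ : Conn (lineSystem hN) Prod.fst D (w, n) (1, m₁))
    (h₂ : Conn (lineSystem hN) Prod.fst D (w, n) (1, m₂)) :
    (m₁ - m₂).natAbs ≤ g := by
  have hM := evenLarge_lineMatrix hN hev
  by_cases hw : w = 1
  · subst hw
    have h0 : D = 0 := Nat.le_zero.1 (hD 0 n (Conn.refl _))
    subst h0
    cases h₁; cases h₂
    simp
  · obtain ⟨i, rfl, hi⟩ := h₁.exists_pos_eq hM hD hw
    obtain ⟨k, rfl, hk⟩ := h₂.exists_pos_eq hM hD hw
    have hl := h₁.symm.length_le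
    rw [(lineSystem hN).length_one, zero_add] at hl
    exact close_natAbs_le hg (close_of_isLeftDescent hM hi hk (hl.trans hDK))

/-- Closest points on the base line of two vertices at distance at most `D` are close. -/
theorem natAbs_sub_le_of_conn_conn (hev : ∀ r, 1 ≤ r → Even (N r)) {D D' L g : ℕ}
    {w w' : (lineMatrix hN).Group} {n n' m m' : ℤ} (hg : ∀ r, 1 ≤ r → N r ≤ 2 * D → r ≤ g)
    (hD : ∀ L m, Conn (lineSystem hN) Prod.fst L (w, n) (1, m) → D ≤ L)
    (hD' : ∀ L m, Conn (lineSystem hN) Prod.fst L (w', n') (1, m) → D' ≤ L) (hL : L ≤ D)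
    (h : Conn (lineSystem hN) Prod.fst L (w, n) (w', n'))
    (h₁ : Conn (lineSystem hN) Prod.fst D (w, n) (1, m))
    (h₂ : Conn (lineSystem hN) Prod.fst D' (w', n') (1, m')) :
    (m - m').natAbs ≤ 2 * g := by
  have hM := evenLarge_lineMatrix hN hev
  by_cases hw' : w' = 1
  · subst hw'
    have h0 : D' = 0 := Nat.le_zero.1 (hD' 0 n' (Conn.refl _))
    subst h0
    cases h₂
    have hDL := hD _ _ h
    obtain rfl : L = D := le_antisymm hL hDL
    have := natAbs_sub_le_of_conn hev hg hD (by omega) h₁ h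
    omega
  · by_cases hw : w = 1
    · subst hw
      have h0 : D = 0 := Nat.le_zero.1 (hD 0 n (Conn.refl _))
      subst h0
      obtain rfl : L = 0 := by omega
      cases h
      exact absurd rfl hw'
    · obtain ⟨i, rfl, hi⟩ := h₁.exists_pos_eq hM hD hw
      obtain ⟨i', rfl, hi'⟩ := h₂.exists_pos_eq hM hD' hw'
      have hl := h₁.symm.length_le
      rw [(lineSystem hN).length_one, zero_add] at hl
      obtain ⟨k, hk, hk'⟩ := h.exists_close hM hD hl hL hi hi'
      have e1 := close_natAbs_le hg hk
      have e2 := close_natAbs_le hg hk'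
      omega

/-- A line at bounded distance from translates along the base line is the base line. -/
theorem eq_one_of_forall_conn (hev : ∀ r, 1 ≤ r → Even (N r)) {w : (lineMatrix hN).Group}
    {P : ℤ} (hP : P ≠ 0) {L : ℕ}
    (h : ∀ n : ℤ, ∃ t, Conn (lineSystem hN) Prod.fst L (w, t) (1, n * P)) : w = 1 := by
  have hM := evenLarge_lineMatrix hN hev
  by_contra hw
  have key : ∀ n : ℤ, ∃ i : ℤ × ℤˣ, (i.1 - n * P).natAbs ≤ 2 * L ∧
      (lineSystem hN).IsLeftDescent w i := by
    intro n
    obtain ⟨t, ht⟩ := h n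
    have hex : ∃ K m, Conn (lineSystem hN) Prod.fst K (w, t) (1, m) := ⟨_, _, ht⟩
    classical
    obtain ⟨c, hc⟩ := Nat.find_spec hex
    have hmin : ∀ K m, Conn (lineSystem hN) Prod.fst K (w, t) (1, m) → Nat.find hex ≤ K :=
      fun K m hK => Nat.find_min' hex ⟨m, hK⟩
    obtain ⟨i, rfl, hi⟩ := hc.exists_pos_eq hM hmin hw
    refine ⟨i, ?_, hi⟩
    have := (hc.symm.trans ht).natAbs_le
    have := hmin _ _ ht
    simp only at *
    omega
  obtain ⟨i, hi, hi'⟩ := key 0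
  obtain ⟨j, hj, hj'⟩ := key (4 * L + 1)
  obtain ⟨k, hk, hk'⟩ := key (2 * (4 * L + 1))
  have hP' : ∀ c : ℤ, 0 < c → c ≤ ((c * P).natAbs : ℤ) := by
    intro c hc
    rw [Int.natCast_natAbs, abs_mul, abs_of_pos hc]
    have := Int.one_le_abs hP
    nlinarith
  have h1 := hP' (4 * L + 1) (by omega)
  have e : (2 * (4 * (L : ℤ) + 1)) * P = (4 * L + 1) * P + (4 * L + 1) * P := by ring
  rw [e] at hk
  rw [zero_mul] at hi
  generalize (4 * (L : ℤ) + 1) * P = z at *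
  have hij : i ≠ j := by rintro rfl; omega
  have hik : i ≠ k := by rintro rfl; omega
  have hjk : j ≠ k := by rintro rfl; omega
  rcases isLeftDescent_two (lineSystem hN) hM hi' hj' hk' hij with h | h
  · exact hik h.symm
  · exact hjk h.symm

theorem exists_list_gens (g : (presentation N hN).Grp) : ∃ l : List (presentation N hN).Grp,
    (∀ x ∈ l, x ∈ (presentation N hN).gens ∨ x⁻¹ ∈ (presentation N hN).gens) ∧ l.prod = g := by
  have hg : g ∈ (Subgroup.closure (Set.range
      (PresentedGroup.of (rels := wordVal '' (presentation N hN).rels)))).toSubmonoid := by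
    rw [PresentedGroup.closure_range_of]; trivial
  rw [Subgroup.closure_toSubmonoid] at hg
  exact Submonoid.exists_list_of_mem_closure hg

theorem conn_wordLength (g h : (presentation N hN).Grp) : Conn (lineSystem hN) Prod.fst
    (wordLength (presentation N hN).gens (g⁻¹ * h)) (orbit hN g) (orbit hN h) := by
  rw [conn_orbit_iff]
  obtain ⟨l, hl, hg⟩ := exists_list_gens (g⁻¹ * h)
  exact Nat.sInf_mem (s := {n : ℕ | ∃ l : List (presentation N hN).Grp, l.length = n ∧
    (∀ x ∈ l, x ∈ (presentation N hN).gens ∨ x⁻¹ ∈ (presentation N hN).gens) ∧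
    l.prod = g⁻¹ * h}) ⟨_, l, rfl, hl, hg⟩

theorem wordLength_le {g h : (presentation N hN).Grp} {L : ℕ}
    (hL : Conn (lineSystem hN) Prod.fst L (orbit hN g) (orbit hN h)) :
    wordLength (presentation N hN).gens (g⁻¹ * h) ≤ L :=
  Nat.sInf_le ((conn_orbit_iff hN).1 hL)

theorem wdist_genA_zpow_le (m n : ℤ) : wdist (presentation N hN).gens (genA hN ^ m) (genA hN ^ n) ≤
    (m - n).natAbs := by
  refine Nat.cast_le.2 (wordLength_le ?_)
  rw [orbit_zpow, orbit_zpow]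
  exact Conn.travel _ _ _

theorem exists_setDist (x : (presentation N hN).Grp) : ∃ D : ℕ,
    setDist (presentation N hN).gens x (Subgroup.zpowers (genA hN)) = D ∧
    (∀ K m, Conn (lineSystem hN) Prod.fst K (orbit hN x) (1, m) → D ≤ K) ∧
    (∃ m, Conn (lineSystem hN) Prod.fst D (orbit hN x) (1, m)) ∧
    ∀ y ∈ proj (presentation N hN).gens (Subgroup.zpowers (genA hN)) x, ∃ m : ℤ,
      y = genA hN ^ m ∧ Conn (lineSystem hN) Prod.fst D (orbit hN x) (1, m) := by
  classical
  have hex : ∃ K m, Conn (lineSystem hN) Prod.fst K (orbit hN x) (1, m) := by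
    have h := conn_wordLength x (genA hN ^ (0 : ℤ))
    rw [orbit_zpow] at h
    exact ⟨_, _, h⟩
  have hmin : ∀ K m, Conn (lineSystem hN) Prod.fst K (orbit hN x) (1, m) → Nat.find hex ≤ K :=
      fun K m hK => Nat.find_min' hex ⟨m, hK⟩
  have hdist : setDist (presentation N hN).gens x (Subgroup.zpowers (genA hN)) =
      (Nat.find hex : ℝ) := by
    refine IsLeast.csInf_eq ⟨?_, ?_⟩
    · obtain ⟨m, hm⟩ := Nat.find_spec hex
      refine ⟨genA hN ^ m, ⟨m, rfl⟩, Nat.cast_inj.2 (le_antisymm (wordLength_le ?_) (hmin _ m ?_))⟩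
      · rwa [orbit_zpow]
      · rw [← orbit_zpow]; exact conn_wordLength _ _
    · rintro _ ⟨_, ⟨m, rfl⟩, rfl⟩
      refine Nat.cast_le.2 (hmin _ m ?_)
      rw [← orbit_zpow]; exact conn_wordLength _ _
  refine ⟨Nat.find hex, hdist, hmin, Nat.find_spec hex, ?_⟩
  rintro _ ⟨⟨m, rfl⟩, hy⟩
  refine ⟨m, rfl, ?_⟩
  rw [hdist] at hy
  have h := conn_wordLength x (genA hN ^ m)
  rwa [Nat.cast_inj.1 hy, orbit_zpow] at h

/-- The contraction estimate for the base line. -/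
theorem wdist_proj_le (hev : ∀ r, 1 ≤ r → Even (N r)) {x x' : (presentation N hN).Grp} {D g : ℕ}
    (hxD : setDist (presentation N hN).gens x (Subgroup.zpowers (genA hN)) = D)
    (hg : ∀ r, 1 ≤ r → N r ≤ 2 * D → r ≤ g)
    (hx : wdist (presentation N hN).gens x x' ≤ D) {y y' : (presentation N hN).Grp}
    (hy : y ∈ proj (presentation N hN).gens (Subgroup.zpowers (genA hN)) x ∪
      proj (presentation N hN).gens (Subgroup.zpowers (genA hN)) x')
    (hy' : y' ∈ proj (presentation N hN).gens (Subgroup.zpowers (genA hN)) x ∪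
      proj (presentation N hN).gens (Subgroup.zpowers (genA hN)) x') :
    wdist (presentation N hN).gens y y' ≤ (2 * g : ℕ) := by
  obtain ⟨D₀, hD₀, hmin, ⟨m₀, hm₀⟩, hproj⟩ := exists_setDist x
  obtain ⟨D', -, hmin', -, hproj'⟩ := exists_setDist x'
  obtain rfl : D₀ = D := Nat.cast_inj.1 (hD₀.symm.trans hxD)
  have hL : wordLength (presentation N hN).gens (x⁻¹ * x') ≤ D₀ := Nat.cast_le.1 hx
  have hconn := conn_wordLength x x'
  have main : ∀ m m', (Conn (lineSystem hN) Prod.fst D₀ (orbit hN x) (1, m) ∨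
      Conn (lineSystem hN) Prod.fst D' (orbit hN x') (1, m)) →
      (Conn (lineSystem hN) Prod.fst D₀ (orbit hN x) (1, m') ∨
      Conn (lineSystem hN) Prod.fst D' (orbit hN x') (1, m')) → (m - m').natAbs ≤ 2 * g := by
    intro m m' h h'
    rcases h with h | h <;> rcases h' with h' | h'
    · have := natAbs_sub_le_of_conn hev hg hmin (by omega) h h'
      omega
    · exact natAbs_sub_le_of_conn_conn hev hg hmin hmin' hL hconn h h'
    · have := natAbs_sub_le_of_conn_conn hev hg hmin hmin' hL hconn h' h
      omega
    · have hD' : D' ≤ 2 * D₀ := by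
        have := hmin' _ _ (hconn.symm.trans hm₀)
        omega
      have := natAbs_sub_le_of_conn hev hg hmin' hD' h h'
      omega
  have mem : ∀ y ∈ proj (presentation N hN).gens (Subgroup.zpowers (genA hN)) x ∪
      proj (presentation N hN).gens (Subgroup.zpowers (genA hN)) x', ∃ m : ℤ, y = genA hN ^ m ∧
      (Conn (lineSystem hN) Prod.fst D₀ (orbit hN x) (1, m) ∨
        Conn (lineSystem hN) Prod.fst D' (orbit hN x') (1, m)) := by
    rintro y (hy | hy)
    · obtain ⟨m, h1, h2⟩ := hproj y hy
      exact ⟨m, h1, Or.inl h2⟩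
    · obtain ⟨m, h1, h2⟩ := hproj' y hy
      exact ⟨m, h1, Or.inr h2⟩
  obtain ⟨m, rfl, h⟩ := mem y hy
  obtain ⟨m', rfl, h'⟩ := mem y' hy'
  exact (wdist_genA_zpow_le m m').trans (Nat.cast_le.2 (main m m' h h'))

theorem genA_zpow_ne_one {n : ℤ} (hn : n ≠ 0) : genA hN ^ n ≠ 1 := by
  intro h
  have h1 := orbit_zpow hN n
  rw [h, ← zpow_zero (genA hN), orbit_zpow] at h1
  exact hn (congrArg Prod.snd h1).symm

/-- Every virtually cyclic subgroup containing the first generator is generated by it. -/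
theorem eq_zpowers_of_virtuallyCyclic (hev : ∀ r, 1 ≤ r → Even (N r))
    {E : Subgroup (presentation N hN).Grp} (hE : VirtuallyCyclic E) (ha : genA hN ∈ E) :
    E = Subgroup.zpowers (genA hN) := by
  refine le_antisymm (fun g hg => ?_) (by simpa using ha)
  obtain ⟨h, hhE, hidx⟩ := hE
  have hpow : ∀ x ∈ E, ∃ k : ℕ, 0 < k ∧ x ^ k ∈ Subgroup.zpowers h := by
    intro x hx
    obtain ⟨k, hk, -, hmem⟩ := Subgroup.exists_pow_mem_of_index_ne_zero hidx ⟨x, hx⟩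
    exact ⟨k, hk, hmem⟩
  obtain ⟨p, hp, q, hq⟩ := hpow _ ha
  have hhmem : h ∈ E := hhE (Subgroup.mem_zpowers h)
  obtain ⟨k, hk, l, hl⟩ := hpow (g⁻¹ * h * g) (E.mul_mem (E.mul_mem (E.inv_mem hg) hhmem) hg)
  simp only at hq hl
  have hconj : ∀ x : (presentation N hN).Grp, ∀ n : ℤ, (g⁻¹ * x * g) ^ n = g⁻¹ * x ^ n * g := by
    intro x n
    have := conj_zpow (i := n) (a := g⁻¹) (b := x)
    simpa using this
  have hPQ : g⁻¹ * genA hN ^ ((p * k : ℕ) : ℤ) * g = genA hN ^ (p * l : ℤ) := by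
    have e1 : genA hN ^ ((p * k : ℕ) : ℤ) = (h ^ (k : ℤ)) ^ q := by
      rw [zpow_natCast, pow_mul, ← hq, ← zpow_natCast, ← zpow_mul, mul_comm, zpow_mul]
    have e2 : (h ^ l) ^ q = genA hN ^ (p * l : ℤ) := by
      rw [← zpow_mul, mul_comm, zpow_mul, hq, ← zpow_natCast, ← zpow_mul]
    rw [e1, ← e2, hl, ← zpow_natCast, hconj, hconj]
  have hP : (p * l : ℤ) ≠ 0 := by
    intro h0
    rw [h0, zpow_zero] at hPQ
    have : genA hN ^ ((p * k : ℕ) : ℤ) = 1 := by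
      rw [mul_eq_one_iff_eq_inv] at hPQ
      exact mul_eq_left.1 hPQ
    exact genA_zpow_ne_one (by positivity) this
  have h1 : (orbit hN g⁻¹).1 = 1 := by
    refine eq_one_of_forall_conn hev hP (L := wordLength (presentation N hN).gens g) fun n => ?_
    refine ⟨(orbit hN g⁻¹).2 + n * ((p * k : ℕ) : ℤ) * sgn hN (orbit hN g⁻¹).1, ?_⟩
    have h2 := conn_wordLength (g⁻¹ * genA hN ^ (n * ((p * k : ℕ) : ℤ)))
      (genA hN ^ (n * (p * l : ℤ)))
    have e : (g⁻¹ * genA hN ^ (n * ((p * k : ℕ) : ℤ)))⁻¹ * genA hN ^ (n * (p * l : ℤ)) = g := by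
      rw [mul_comm n, zpow_mul, mul_comm n, zpow_mul, ← hPQ, hconj]
      group
    rwa [e, orbit_mul, act_genA_zpow, orbit_zpow] at h2
  have h2 : orbit hN g⁻¹ = orbit hN (genA hN ^ (orbit hN g⁻¹).2) := by
    rw [orbit_zpow, ← h1]
  have h3 := orbit_injective hN h2
  rw [← inv_inv g, h3]
  exact Subgroup.inv_mem _ ⟨_, rfl⟩

end Metric

section Assembly

open Filter

variable {N : ℕ → ℕ} {hN : ∀ r, 1 ≤ r → 6 ≤ N r}

theorem relator_ne_one (hev : ∀ r, 1 ≤ r → Even (N r)) {r : ℕ} (hr : 1 ≤ r) :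
    genA hN ^ r * genB hN * genA hN ^ r * (genB hN)⁻¹ ≠ 1 := by
  intro h
  have h1 : orbit hN (genA hN ^ r * genB hN * genA hN ^ r * (genB hN)⁻¹) =
      ((lineSystem hN).simple ((r : ℤ), 1) * (lineSystem hN).simple ((0 : ℤ), 1), 0) := by
    rw [← zpow_natCast, orbit_mul, orbit_mul, orbit_mul, orbit_zpow, act_genB, act_genA_zpow,
      act_genB_inv]
    simp [sgn_simple, -CoxeterMatrix.toCoxeterSystem_simple]
  rw [h, ← zpow_zero (genA hN), orbit_zpow] at h1
  have hne : ((r : ℤ), (1 : ℤˣ)) ≠ (0, 1) := by simp; omega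
  have h2 := simple_mul_simple_pow_ne_one (lineSystem hN) (evenLarge_lineMatrix hN hev) hne one_pos
    (Or.inr (by
      rw [lineMatrix_apply, if_neg hne, if_pos rfl]
      have := hN r hr
      simp only [sub_zero, Int.natAbs_natCast]
      omega))
  rw [pow_one] at h2
  exact h2 (congrArg Prod.fst h1).symm

theorem relator_isOfFinOrder {r : ℕ} (hr : 1 ≤ r) :
    IsOfFinOrder (genA hN ^ r * genB hN * genA hN ^ r * (genB hN)⁻¹) :=
  isOfFinOrder_iff_pow_eq_one.2 ⟨N r, by have := hN r hr; omega, relator_pow hN hr⟩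

/-- A subgroup of a group containing a nontrivial element of finite order is not free. -/
theorem not_nonempty_freeGroup_mulEquiv {G ι : Type*} [Group G] {H : Subgroup G} {x : G}
    (hx : x ∈ H) (h1 : x ≠ 1) (hfin : IsOfFinOrder x) : ¬ Nonempty (FreeGroup ι ≃* H) := by
  rintro ⟨e⟩
  obtain ⟨n, hn, hxn⟩ := isOfFinOrder_iff_pow_eq_one.1 hfin
  have h : e.symm ⟨x, hx⟩ ^ n = 1 := by
    rw [← map_pow, ← map_one e.symm]
    exact congrArg e.symm (Subtype.ext hxn)
  rw [pow_eq_one_iff_left hn.ne', map_eq_one_iff _ e.symm.injective] at h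
  exact h1 (congrArg Subtype.val h)

theorem relator_mem_normalClosure (r : ℕ) : genA hN ^ r * genB hN * genA hN ^ r * (genB hN)⁻¹ ∈
    Subgroup.normalClosure {genA hN ^ r} := by
  have h : genA hN ^ r ∈ Subgroup.normalClosure {genA hN ^ r} :=
    Subgroup.subset_normalClosure rfl
  have h' := Subgroup.normalClosure_normal.conj_mem _ h (genB hN)
  have := Subgroup.mul_mem _ h h'
  simpa only [mul_assoc] using this

theorem admissible_id_comp_add {ρ : ℝ → ℝ} (hρ : Sublinear ρ) (c : ℝ) :
    Admissible (fun t => t) (fun t => 2 * ρ (t + c)) := by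
  obtain ⟨hmono, hnn, hlim⟩ := hρ
  have hshift : Tendsto (fun t : ℝ => t + c) atTop atTop :=
    tendsto_atTop_add_const_right _ _ tendsto_id
  refine ⟨monotone_id, fun s t hst => ?_, eventually_ge_atTop 0, ?_, fun _ => le_rfl,
    fun M => ⟨M, le_rfl⟩, ?_⟩
  · have := hmono (show s + c ≤ t + c by linarith)
    simp only
    linarith
  · filter_upwards [hshift.eventually hnn] with t ht
    positivity
  · have h1 : Tendsto (fun t : ℝ => (t + c) / t) atTop (nhds 1) := by
      have h2 : Tendsto (fun t : ℝ => 1 + c / t) atTop (nhds (1 + 0)) :=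
        tendsto_const_nhds.add (tendsto_const_nhds.div_atTop tendsto_id)
      rw [add_zero] at h2
      refine h2.congr' ?_
      filter_upwards [eventually_gt_atTop 0] with t ht
      field_simp
    have h3 := ((hlim.comp hshift).mul h1).const_mul 2
    rw [zero_mul, mul_zero] at h3
    refine h3.congr' ?_
    filter_upwards [eventually_gt_atTop 0, hshift.eventually (eventually_gt_atTop 0)] with t ht ht'
    simp only [Function.comp]
    field_simp

theorem asymp_two_mul_comp_add {ρ : ℝ → ℝ} (hρ : Monotone ρ) {c : ℝ} (hc : 0 ≤ c) :
    Asymp (fun t => 2 * ρ (t + c)) ρ := by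
  refine ⟨⟨2, 1, c, 0, two_pos, one_pos, hc, le_rfl, fun x => by simp⟩,
    ⟨1 / 2, 1, 0, 0, by norm_num, one_pos, le_rfl, le_rfl, fun x => ?_⟩⟩
  have := hρ (show x ≤ 1 * x + 0 + c by linarith)
  simp only
  linarith

end Assembly

/-- For every unbounded sublinear `ρ₂` there are exponents `N_r ≥ 6`
such that `R = {(a^r b a^r b⁻¹)^{N_r}}` is a classical C'(1/6) collection and the
presented group `G = ⟨a,b | R⟩` satisfies: (i) every virtually cyclic subgroup `E`
containing `a` is `(r,ρ₂')`-contracting for some `ρ₂' ≍ ρ₂`; (ii) each element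
`a^r b a^r b⁻¹` is nontrivial of finite order, so the normal closure of `a^r` is never
a free group. -/
theorem statement13 (ρ₂ : ℝ → ℝ) (hρ₂ : Sublinear ρ₂)
    (hunb : ∀ M : ℝ, ∃ r : ℝ, M ≤ ρ₂ r) :
    ∃ N : ℕ → ℕ, (∀ r : ℕ, 1 ≤ r → 6 ≤ N r) ∧
      CprimeCollection 6 {w : Word (Fin 2) | ∃ r : ℕ, 1 ≤ r ∧ w = relWord13 r (N r)} ∧
      ∃ P : C6Presentation (Fin 2),
        P.rels = symmClosure {w : Word (Fin 2) | ∃ r : ℕ, 1 ≤ r ∧ w = relWord13 r (N r)} ∧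
        (∃ ρ₂' : ℝ → ℝ, Asymp ρ₂' ρ₂ ∧
          ∀ E : Subgroup P.Grp, VirtuallyCyclic E →
            (PresentedGroup.of (0 : Fin 2) : P.Grp) ∈ E →
            ContractingWith P.gens (fun t => t) ρ₂' ((E : Set P.Grp))) ∧
        (∀ r : ℕ, 1 ≤ r →
          (PresentedGroup.of (0 : Fin 2) : P.Grp) ^ r * PresentedGroup.of (1 : Fin 2) *
              (PresentedGroup.of (0 : Fin 2) : P.Grp) ^ r *
              (PresentedGroup.of (1 : Fin 2) : P.Grp)⁻¹ ≠ 1 ∧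
          IsOfFinOrder
            ((PresentedGroup.of (0 : Fin 2) : P.Grp) ^ r * PresentedGroup.of (1 : Fin 2) *
              (PresentedGroup.of (0 : Fin 2) : P.Grp) ^ r *
              (PresentedGroup.of (1 : Fin 2) : P.Grp)⁻¹)) ∧
        (∀ r : ℕ, 1 ≤ r →
          ¬ ∃ ι : Type, Nonempty (FreeGroup ι ≃*
            (Subgroup.normalClosure {(PresentedGroup.of (0 : Fin 2) : P.Grp) ^ r} :
              Subgroup P.Grp))) := by
  obtain ⟨hmono, hnn, -⟩ := id hρ₂
  choose X hX using fun r : ℕ => hunb r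
  let N : ℕ → ℕ := fun r => 2 * (⌈X r⌉₊ + 3)
  have hN : ∀ r, 1 ≤ r → 6 ≤ N r := fun r _ => by simp only [N]; omega
  have hev : ∀ r, 1 ≤ r → Even (N r) := fun r _ => even_two_mul _
  obtain ⟨c, hc, hc0⟩ : ∃ c, 0 ≤ ρ₂ c ∧ 0 ≤ c := (hnn.and (Filter.eventually_ge_atTop 0)).exists
  refine ⟨N, hN, cprimeCollection_baseRels hN, presentation N hN, rfl,
    ⟨fun t => 2 * ρ₂ (t + c), asymp_two_mul_comp_add hmono hc0, fun E hE ha => ?_⟩,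
    fun r hr => ⟨relator_ne_one hev hr, relator_isOfFinOrder hr⟩, ?_⟩
  · rw [eq_zpowers_of_virtuallyCyclic hev hE ha]
    refine ⟨admissible_id_comp_add hρ₂ c, fun x _ x' _ hx y hy y' hy' => ?_⟩
    obtain ⟨D, hD, -⟩ := exists_setDist x
    rw [hD] at hx ⊢
    have hpos : 0 ≤ ρ₂ (D + c) := hc.trans (hmono (by simp))
    have hg : ∀ r, 1 ≤ r → N r ≤ 2 * D → r ≤ ⌊ρ₂ (D + c)⌋₊ := by
      intro r _ hr
      refine Nat.le_floor ((hX r).trans (hmono ?_))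
      have h1 : ⌈X r⌉₊ ≤ D := by simp only [N] at hr; omega
      have h2 := Nat.ceil_le.1 h1
      linarith
    refine (wdist_proj_le hev hD hg hx hy hy').trans ?_
    push_cast
    have := Nat.floor_le hpos
    linarith
  · rintro r hr ⟨ι, h⟩
    exact not_nonempty_freeGroup_mulEquiv (relator_mem_normalClosure r) (relator_ne_one hev hr)
      (relator_isOfFinOrder hr) h

end GSC
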